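/- arXiv:2304.14744 — 2 statements merged into one kernel-verified Lean document; each statement's English description precedes it below -/
import Mathlib

section
/- There exist constants η > 0 and C > 0 such that for all ζ, θ ∈ ℝ and μ, λ > 0 with |ζ + π/2| + |μ − 1| + |θ| + λ ≤ η, and every Schwartz function g : ℝ^N → ℂ, setting V = e^{iζ}W_μ + e^{iθ}W_λ, one has |Re ∫_{ℝ^N} conj(ΔV)·Δg dx − Re ∫_{ℝ^N} conj(f(V))·g dx| ≤ C·λ^{(N+4)/4}·(∫_{ℝ^N} |Δg|² dx)^{1/2}. -/
open MeasureTheory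

noncomputable section

abbrev Rn (N : ℕ) : Type := EuclideanSpace ℝ (Fin N)

noncomputable def lapR {N : ℕ} (u : Rn N → ℝ) (x : Rn N) : ℝ :=
  ∑ i : Fin N, iteratedFDeriv ℝ 2 u x (fun _ => EuclideanSpace.single i 1)

noncomputable def lapC {N : ℕ} (u : Rn N → ℂ) (x : Rn N) : ℂ :=
  ∑ i : Fin N, iteratedFDeriv ℝ 2 u x (fun _ => EuclideanSpace.single i 1)

noncomputable def Wfun (N : ℕ) (x : Rn N) : ℝ :=
  ((N : ℝ) * ((N : ℝ) - 4) * ((N : ℝ) ^ 2 - 4)) ^ (((N : ℝ) - 4) / 8) *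
    (1 + ‖x‖ ^ 2) ^ (-(((N : ℝ) - 4) / 2))

noncomputable def LamR {N : ℕ} (v : Rn N → ℝ) (x : Rn N) : ℝ :=
  (((N : ℝ) - 4) / 2) * v x + fderiv ℝ v x x

noncomputable def LamC {N : ℕ} (v : Rn N → ℂ) (x : Rn N) : ℂ :=
  ((((N : ℝ) - 4) / 2) : ℝ) * v x + fderiv ℝ v x x

noncomputable def rescR {N : ℕ} (lam : ℝ) (u : Rn N → ℝ) (x : Rn N) : ℝ :=
  lam ^ (-(((N : ℝ) - 4) / 2)) * u (lam⁻¹ • x)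

noncomputable def fNL (N : ℕ) (z : ℂ) : ℂ :=
  Complex.ofReal (‖z‖ ^ ((8 : ℝ) / ((N : ℝ) - 4))) * z

noncomputable def fNL' (N : ℕ) (z w : ℂ) : ℂ :=
  if z = 0 then 0 else
    Complex.ofReal (‖z‖ ^ ((8 : ℝ) / ((N : ℝ) - 4))) *
      (w + Complex.ofReal (((8 : ℝ) / ((N : ℝ) - 4)) * ((((starRingEnd ℂ) z) * w).re / ‖z‖ ^ 2)) * z)

noncomputable def FNL (N : ℕ) (z : ℂ) : ℝ :=
  (((N : ℝ) - 4) / (2 * (N : ℝ))) * ‖z‖ ^ ((2 * (N : ℝ)) / ((N : ℝ) - 4))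

noncomputable def cexp (θ : ℝ) : ℂ := Complex.exp (Complex.I * θ)

noncomputable def pairC {N : ℕ} (v w : Rn N → ℂ) : ℝ :=
  ∫ x : Rn N, ((starRingEnd ℂ) (v x) * w x).re

noncomputable def energyC {N : ℕ} (u : Rn N → ℂ) : ℝ :=
  (1 / 2) * (∫ x : Rn N, ‖lapC u x‖ ^ 2) - (∫ x : Rn N, FNL N (u x))

noncomputable def enorm2 {N : ℕ} (g : Rn N → ℂ) : ℝ := ∫ x : Rn N, ‖lapC g x‖ ^ 2


open scoped Laplacian LineDeriv SchwartzMap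

/-- the regularised power `(a ^ 2 + |x| ^ 2) ^ s` -/
def qf {N : ℕ} (a s : ℝ) (x : Rn N) : ℝ := (a ^ 2 + ‖x‖ ^ 2) ^ s

lemma base_pos {N : ℕ} {a : ℝ} (ha : 0 < a) (x : Rn N) : 0 < a ^ 2 + ‖x‖ ^ 2 := by positivity

lemma qf_pos {N : ℕ} {a : ℝ} (ha : 0 < a) (s : ℝ) (x : Rn N) : 0 < qf a s x :=
  Real.rpow_pos_of_pos (base_pos ha x) s

lemma qf_eq {N : ℕ} {a : ℝ} (ha : 0 < a) (s : ℝ) (x : Rn N) :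
    qf a s x = (a ^ 2) ^ s * (1 + ‖a⁻¹ • x‖ ^ 2) ^ s := by
  rw [← Real.mul_rpow (by positivity) (by positivity)]
  unfold qf
  congr 1
  rw [norm_smul, norm_inv, Real.norm_eq_abs, abs_of_pos ha]
  field_simp

lemma qf_temperate {N : ℕ} {a : ℝ} (ha : 0 < a) (s : ℝ) :
    (qf (N := N) a s).HasTemperateGrowth := by
  have h1 : (qf (N := N) a s) = fun x => (a ^ 2) ^ s * (1 + ‖a⁻¹ • x‖ ^ 2) ^ s :=
    funext (qf_eq ha s)
  rw [h1]
  have h2 := (Function.hasTemperateGrowth_one_add_norm_sq_rpow (Rn N) s).comp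
    ((a⁻¹ • ContinuousLinearMap.id ℝ (Rn N)).hasTemperateGrowth)
  exact (Function.HasTemperateGrowth.const ((a ^ 2) ^ s)).mul h2

lemma qf_add_one {N : ℕ} {a : ℝ} (ha : 0 < a) (s : ℝ) (x : Rn N) :
    ‖x‖ ^ 2 * qf a s x = qf a (s + 1) x - a ^ 2 * qf a s x := by
  unfold qf
  rw [Real.rpow_add_one (base_pos ha x).ne']
  ring

lemma qf_hasFDerivAt {N : ℕ} {a : ℝ} (ha : 0 < a) (s : ℝ) (x : Rn N) :
    HasFDerivAt (qf (N := N) a s) ((2 * s * qf a (s - 1) x) • innerSL ℝ x) x := by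
  have h1 : HasFDerivAt (fun y : Rn N => a ^ 2 + ‖y‖ ^ 2) (2 • innerSL ℝ x) x :=
    ((hasStrictFDerivAt_norm_sq x).hasFDerivAt).const_add _
  have h2 := h1.rpow_const (p := s) (Or.inl (base_pos ha x).ne')
  refine h2.congr_fderiv ?_
  unfold qf
  ext y
  simp
  ring

abbrev ee {N : ℕ} (i : Fin N) : Rn N := EuclideanSpace.single i (1 : ℝ)

def q1 {N : ℕ} (a s : ℝ) (i : Fin N) (x : Rn N) : ℝ := 2 * s * (x i * qf a (s - 1) x)
def q2 {N : ℕ} (a s : ℝ) (i : Fin N) (x : Rn N) : ℝ :=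
  2 * s * (qf a (s - 1) x + x i * (2 * (s - 1) * (x i * qf a (s - 1 - 1) x)))

lemma inner_ee {N : ℕ} (i : Fin N) (x : Rn N) : inner ℝ x (ee i) = x i := by
  simp [EuclideanSpace.inner_single_right]

lemma coord_hasFDerivAt {N : ℕ} (i : Fin N) (x : Rn N) :
    HasFDerivAt (fun y : Rn N => y i) (EuclideanSpace.proj i : Rn N →L[ℝ] ℝ) x :=
  (EuclideanSpace.proj i : Rn N →L[ℝ] ℝ).hasFDerivAt

lemma qf_fderiv_ee {N : ℕ} {a : ℝ} (ha : 0 < a) (s : ℝ) (i : Fin N) (x : Rn N) :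
    fderiv ℝ (qf (N := N) a s) x (ee i) = q1 a s i x := by
  rw [(qf_hasFDerivAt ha s x).fderiv]
  simp only [smul_apply, innerSL_apply_apply, inner_ee, q1, smul_eq_mul]
  ring

lemma q1_hasFDerivAt {N : ℕ} {a : ℝ} (ha : 0 < a) (s : ℝ) (i : Fin N) (x : Rn N) :
    HasFDerivAt (q1 (N := N) a s i) ((2 * s) • (x i • ((2 * (s - 1) * qf a (s - 1 - 1) x) • innerSL ℝ x)
      + qf a (s - 1) x • (EuclideanSpace.proj i : Rn N →L[ℝ] ℝ))) x :=
  ((coord_hasFDerivAt i x).mul (qf_hasFDerivAt ha (s - 1) x)).const_mul (2 * s)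

lemma q1_fderiv_ee {N : ℕ} {a : ℝ} (ha : 0 < a) (s : ℝ) (i : Fin N) (x : Rn N) :
    fderiv ℝ (q1 (N := N) a s i) x (ee i) = q2 a s i x := by
  rw [(q1_hasFDerivAt ha s i x).fderiv]
  simp only [smul_apply, add_apply, innerSL_apply_apply,
    inner_ee, q2, smul_eq_mul]
  simp
  ring_nf
  tauto

lemma coord_temperate {N : ℕ} (i : Fin N) : (fun y : Rn N => y i).HasTemperateGrowth :=
  (EuclideanSpace.proj i : Rn N →L[ℝ] ℝ).hasTemperateGrowth

lemma q1_temperate {N : ℕ} {a : ℝ} (ha : 0 < a) (s : ℝ) (i : Fin N) :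
    (q1 (N := N) a s i).HasTemperateGrowth :=
  (Function.HasTemperateGrowth.const _).mul ((coord_temperate i).mul (qf_temperate ha _))

lemma q2_temperate {N : ℕ} {a : ℝ} (ha : 0 < a) (s : ℝ) (i : Fin N) :
    (q2 (N := N) a s i).HasTemperateGrowth :=
  (Function.HasTemperateGrowth.const _).mul ((qf_temperate ha _).add
    ((coord_temperate i).mul (q1_temperate ha _ i)))

/-- the Laplacian of `qf` -/
def qL {N : ℕ} (a s : ℝ) (x : Rn N) : ℝ :=
  (2 * s * N + 4 * s * (s - 1)) * qf a (s - 1) x - 4 * a ^ 2 * s * (s - 1) * qf a (s - 2) x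

lemma sum_q2 {N : ℕ} {a : ℝ} (ha : 0 < a) (s : ℝ) (x : Rn N) :
    ∑ i, q2 (N := N) a s i x = qL a s x := by
  have h1 : ∀ i, q2 (N := N) a s i x
      = 2 * s * qf a (s - 1) x + 4 * s * (s - 1) * qf a (s - 2) x * (x i) ^ 2 := by
    intro i
    unfold q2
    rw [show s - 1 - 1 = s - 2 by ring]
    ring
  simp only [h1, Finset.sum_add_distrib, ← Finset.mul_sum]
  have h2 : ∑ i, (x i) ^ 2 = ‖x‖ ^ 2 := by
    rw [EuclideanSpace.norm_sq_eq]; simp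
  have h3 := qf_add_one ha (s - 2) x
  rw [show s - 2 + 1 = s - 1 by ring] at h3
  rw [h2, qL]
  simp only [Finset.sum_const, Finset.card_univ, Fintype.card_fin, nsmul_eq_mul]
  linear_combination 4 * s * (s - 1) * h3

lemma temp_int {N : ℕ} {φ : Rn N → ℝ} (hφ : φ.HasTemperateGrowth) {F : Type*}
    [NormedAddCommGroup F] [NormedSpace ℝ F] (G : 𝓢(Rn N, F)) :
    Integrable (fun x => φ x • G x) := by
  have := (SchwartzMap.smulLeftCLM F φ G).integrable (μ := volume)
  rwa [SchwartzMap.smulLeftCLM_apply hφ] at this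

lemma ibp_step {N : ℕ} {φ φ' : Rn N → ℝ} (hφ : φ.HasTemperateGrowth)
    (hφ' : φ'.HasTemperateGrowth) (i : Fin N)
    (hd : ∀ x, fderiv ℝ φ x (ee i) = φ' x) (hdiff : Differentiable ℝ φ) {F : Type*}
    [NormedAddCommGroup F] [NormedSpace ℝ F] (G : 𝓢(Rn N, F)) :
    ∫ x, φ x • (∂_{ee i} G : 𝓢(Rn N, F)) x = - ∫ x, φ' x • G x := by
  apply integral_bilinear_hasLineDerivAt_right_eq_neg_left_of_integrable (v := ee i)
    (B := ContinuousLinearMap.lsmul ℝ ℝ (E := F))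
  · exact temp_int hφ' G
  · exact temp_int hφ _
  · exact temp_int hφ _
  · intro x _
    rw [← hd x]
    exact (hdiff x).hasFDerivAt.hasLineDerivAt _
  · intro x _
    exact (G.differentiableAt).hasFDerivAt.hasLineDerivAt _

lemma lap_sum {N : ℕ} {F : Type*} [NormedAddCommGroup F] [NormedSpace ℝ F] (G : 𝓢(Rn N, F)) :
    Δ G = ∑ i : Fin N, ∂_{ee i} (∂_{ee i} G) := by
  rw [SchwartzMap.laplacian_eq_sum (EuclideanSpace.basisFun (Fin N) ℝ)]
  simp

lemma ibp_q {N : ℕ} {a : ℝ} (ha : 0 < a) (s : ℝ) {F : Type*}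
    [NormedAddCommGroup F] [NormedSpace ℝ F] (G : 𝓢(Rn N, F)) :
    ∫ x, qf a s x • (Δ G : 𝓢(Rn N, F)) x = ∫ x, qL a s x • G x := by
  have h1 : ∀ x, qf a s x • (Δ G : 𝓢(Rn N, F)) x
      = ∑ i : Fin N, qf a s x • (∂_{ee i} (∂_{ee i} G) : 𝓢(Rn N, F)) x := by
    intro x
    rw [lap_sum, sum_apply, Finset.smul_sum]
  have h2 : ∀ x, qL a s x • G x = ∑ i : Fin N, q2 a s i x • G x := by
    intro x
    rw [← sum_q2 ha, Finset.sum_smul]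
  simp only [h1, h2]
  rw [integral_finsetSum _ (fun i _ => temp_int (qf_temperate ha s) _),
    integral_finsetSum _ (fun i _ => temp_int (q2_temperate ha s i) _)]
  refine Finset.sum_congr rfl fun i _ => ?_
  rw [ibp_step (qf_temperate ha s) (q1_temperate ha s i) i (qf_fderiv_ee ha s i)
      (fun x => (qf_hasFDerivAt ha s x).differentiableAt),
    ibp_step (q1_temperate ha s i) (q2_temperate ha s i) i (q1_fderiv_ee ha s i)
      (fun x => (q1_hasFDerivAt ha s i x).differentiableAt), neg_neg]

lemma lapC_schwartz {N : ℕ} (g : 𝓢(Rn N, ℂ)) (x : Rn N) : lapC (⇑g) x = (Δ g : 𝓢(Rn N, ℂ)) x := by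
  rw [SchwartzMap.laplacian_apply,
    InnerProductSpace.laplacian_eq_iteratedFDeriv_orthonormalBasis _ (EuclideanSpace.basisFun (Fin N) ℝ)]
  simp only [lapC, EuclideanSpace.basisFun_apply]
  refine Finset.sum_congr rfl fun i _ => ?_
  congr 1
  ext j
  fin_cases j <;> rfl

lemma qf_contDiff {N : ℕ} {a : ℝ} (ha : 0 < a) (s : ℝ) : ContDiff ℝ 2 (qf (N := N) a s) :=
  contDiff_infty.1 (qf_temperate ha s).1 2

lemma lap_qf {N : ℕ} {a : ℝ} (ha : 0 < a) (s : ℝ) (x : Rn N) :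
    Δ (qf (N := N) a s) x = qL a s x := by
  rw [InnerProductSpace.laplacian_eq_iteratedFDeriv_orthonormalBasis _ (EuclideanSpace.basisFun (Fin N) ℝ)]
  simp only [EuclideanSpace.basisFun_apply, iteratedFDeriv_two_apply]
  rw [← sum_q2 ha]
  refine Finset.sum_congr rfl fun i _ => ?_
  have h1 : DifferentiableAt ℝ (fderiv ℝ (qf (N := N) a s)) x :=
    ((qf_contDiff ha s).fderiv_right (m := 1) (by norm_num)).differentiable (by norm_num) x
  have h2 := fderiv_clm_apply h1 (differentiableAt_const (ee i))
  rw [← q1_fderiv_ee ha, ← funext (qf_fderiv_ee ha s i), h2]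
  simp

lemma lapC_comb {N : ℕ} {a b : ℝ} (ha : 0 < a) (hb : 0 < b) (s : ℝ) (A B : ℂ) (x : Rn N) :
    lapC (fun y : Rn N => A * (qf a s y : ℂ) + B * (qf b s y : ℂ)) x
      = A * (qL a s x : ℂ) + B * (qL b s x : ℂ) := by
  have h0 : lapC (fun y : Rn N => A * (qf a s y : ℂ) + B * (qf b s y : ℂ)) x
      = Δ (fun y : Rn N => A * (qf a s y : ℂ) + B * (qf b s y : ℂ)) x := by
    rw [InnerProductSpace.laplacian_eq_iteratedFDeriv_orthonormalBasis _ (EuclideanSpace.basisFun (Fin N) ℝ)]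
    simp only [lapC, EuclideanSpace.basisFun_apply]
    refine Finset.sum_congr rfl fun i _ => ?_
    congr 1
    ext j
    fin_cases j <;> rfl
  have hl : ∀ {c : ℝ} (hc : 0 < c), ContDiffAt ℝ 2 (⇑Complex.ofRealCLM ∘ qf (N := N) c s) x ∧
      Δ (⇑Complex.ofRealCLM ∘ qf (N := N) c s) x = (qL c s x : ℂ) := by
    intro c hc
    refine ⟨Complex.ofRealCLM.contDiff.contDiffAt.comp x (qf_contDiff hc s).contDiffAt, ?_⟩
    rw [ContDiffAt.laplacian_CLM_comp_left (qf_contDiff hc s).contDiffAt]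
    simp [lap_qf hc]
  rw [h0]
  have h3 : (fun y : Rn N => A * (qf a s y : ℂ) + B * (qf b s y : ℂ))
      = A • (⇑Complex.ofRealCLM ∘ qf (N := N) a s) + B • (⇑Complex.ofRealCLM ∘ qf (N := N) b s) := by
    ext y; simp
  have hA : ContDiffAt ℝ 2 (A • (⇑Complex.ofRealCLM ∘ qf (N := N) a s)) x := (hl ha).1.const_smul A
  have hB : ContDiffAt ℝ 2 (B • (⇑Complex.ofRealCLM ∘ qf (N := N) b s)) x := (hl hb).1.const_smul B
  rw [h3, ContDiffAt.laplacian_add hA hB,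
    InnerProductSpace.laplacian_smul A (hl ha).1, InnerProductSpace.laplacian_smul B (hl hb).1, (hl ha).2, (hl hb).2]
  simp

/-- real inner product on `ℂ` as a bilinear map -/
def Bin : ℂ →L[ℝ] ℂ →L[ℝ] ℝ :=
  (isBoundedBilinearMap_inner (𝕜 := ℝ) (E := ℂ)).toContinuousLinearMap

lemma Bin_apply (z w : ℂ) : Bin z w = inner ℝ z w := rfl

lemma deriv_pairing {N : ℕ} (v : Rn N) (f h : 𝓢(Rn N, ℂ)) :
    (∂_{v} (SchwartzMap.pairing Bin f h) : 𝓢(Rn N, ℝ))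
      = SchwartzMap.pairing Bin f (∂_{v} h) + SchwartzMap.pairing Bin (∂_{v} f) h := by
  ext x
  rw [SchwartzMap.lineDerivOp_apply_eq_fderiv, SchwartzMap.pairing_apply,
    ContinuousLinearMap.fderiv_of_bilinear Bin f.differentiableAt h.differentiableAt]
  simp [SchwartzMap.lineDerivOp_apply_eq_fderiv, SchwartzMap.pairing_apply_apply]

lemma lap_pairing {N : ℕ} (g : 𝓢(Rn N, ℂ)) (x : Rn N) :
    2 * inner ℝ (g x) ((Δ g : 𝓢(Rn N, ℂ)) x)
      ≤ (Δ (SchwartzMap.pairing Bin g g) : 𝓢(Rn N, ℝ)) x := by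
  rw [lap_sum, lap_sum, sum_apply, sum_apply, inner_sum, Finset.mul_sum]
  refine Finset.sum_le_sum fun i _ => ?_
  simp only [deriv_pairing, LineDeriv.lineDerivOp_add, add_apply, SchwartzMap.pairing_apply_apply,
    Bin_apply]
  rw [real_inner_comm (g x)]
  have := real_inner_self_nonneg (x := (∂_{ee i} g : 𝓢(Rn N, ℂ)) x)
  linarith

lemma schwartz_sq_int {N : ℕ} (g : 𝓢(Rn N, ℂ)) : Integrable (fun x => ‖g x‖ ^ 2) := by
  have := (SchwartzMap.pairing Bin g g).integrable (μ := volume)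
  refine this.congr (Filter.Eventually.of_forall fun x => ?_)
  simp [SchwartzMap.pairing_apply_apply, Bin_apply]

/-- regularised Rellich inequality -/
lemma rellich {N : ℕ} (hN : 13 ≤ N) {a : ℝ} (ha : 0 < a) (g : 𝓢(Rn N, ℂ)) :
    Integrable (fun x => qf a (-2) x * ‖g x‖ ^ 2) ∧
    ∫ x, qf a (-2) x * ‖g x‖ ^ 2 ≤ ∫ x, ‖lapC (⇑g) x‖ ^ 2 := by
  have hN' : (13 : ℝ) ≤ N := by exact_mod_cast hN
  set G := SchwartzMap.pairing Bin g g with hG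
  have hGx : ∀ x, G x = ‖g x‖ ^ 2 := fun x => by
    simp [hG, SchwartzMap.pairing_apply_apply, Bin_apply]
  have I2 : Integrable (fun x => qf a (-2) x * ‖g x‖ ^ 2) := by
    have := temp_int (qf_temperate ha (-2)) G
    simpa only [hGx, smul_eq_mul] using this
  refine ⟨I2, ?_⟩
  have key := ibp_q ha (-1) G
  have IL := temp_int (qf_temperate ha (-1)) (Δ G : 𝓢(Rn N, ℝ))
  have I3 := temp_int (qf_temperate ha (-3)) G
  have ID := schwartz_sq_int (Δ g : 𝓢(Rn N, ℂ))
  simp only [lapC_schwartz]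
  have hsq : ∀ x : Rn N, qf a (-2) x = qf a (-1) x ^ 2 := fun x => by
    unfold qf
    rw [← Real.rpow_mul_natCast (base_pos ha x).le]
    norm_num
  have e1 : ∫ x, (2 * N - 8) * (qf a (-2) x * ‖g x‖ ^ 2) ≤ - ∫ x, qL a (-1) x • G x := by
    rw [← integral_neg]
    refine integral_mono (I2.const_mul _) ?_ fun x => ?_
    · have : (fun x => -(qL a (-1) x • G x)) = fun x =>
          (2 * N - 8 : ℝ) * (qf a (-2) x * ‖g x‖ ^ 2) + 8 * a ^ 2 * (qf a (-3) x • G x) := by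
        ext x
        simp only [qL, hGx, smul_eq_mul]
        norm_num
        ring
      rw [this]
      exact (I2.const_mul _).add (I3.const_mul _)
    · have h3 := qf_pos ha (-3) x
      have : -(qL a (-1) x • G x) =
          (2 * N - 8 : ℝ) * (qf a (-2) x * ‖g x‖ ^ 2) + 8 * a ^ 2 * (qf a (-3) x * ‖g x‖ ^ 2) := by
        simp only [qL, hGx, smul_eq_mul]
        norm_num
        ring
      change _ ≤ -(qL a (-1) x • G x)
      rw [this]
      have : 0 ≤ 8 * a ^ 2 * (qf a (-3) x * ‖g x‖ ^ 2) := by positivity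
      linarith
  have e2 : - ∫ x, qf a (-1) x • (Δ G : 𝓢(Rn N, ℝ)) x
      ≤ ∫ x, (qf a (-2) x * ‖g x‖ ^ 2 + ‖(Δ g : 𝓢(Rn N, ℂ)) x‖ ^ 2) := by
    rw [← integral_neg]
    refine integral_mono IL.neg (I2.add ID) fun x => ?_
    have h1 := lap_pairing g x
    have h2 := abs_real_inner_le_norm (g x) ((Δ g : 𝓢(Rn N, ℂ)) x)
    have h3 := qf_pos ha (-1) x
    have h4 := (abs_le.1 h2).1
    simp only [smul_eq_mul, hsq]
    have h5 : -(qf a (-1) x * (Δ G : 𝓢(Rn N, ℝ)) x)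
        ≤ qf a (-1) x * (2 * (‖g x‖ * ‖(Δ g : 𝓢(Rn N, ℂ)) x‖)) := by
      rw [← mul_neg]
      refine mul_le_mul_of_nonneg_left ?_ h3.le
      rw [hG]
      linarith
    nlinarith [sq_nonneg (qf a (-1) x * ‖g x‖ - ‖(Δ g : 𝓢(Rn N, ℂ)) x‖)]
  rw [integral_const_mul] at e1
  rw [integral_add I2 ID] at e2
  rw [key] at e2
  have e0 : 0 ≤ ∫ x, qf a (-2) x * ‖g x‖ ^ 2 :=
    integral_nonneg fun x => mul_nonneg (qf_pos ha _ x).le (by positivity)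
  nlinarith

lemma pow_mono_aux {α a b : ℝ} (h0 : 0 < α) (h1 : α ≤ 1) (ha : 0 ≤ a) (hb : 0 ≤ b) :
    |a ^ α - b ^ α| * b ≤ b ^ α * |a - b| := by
  rcases hb.eq_or_lt with rfl | hb
  · simp; positivity
  have hba : b ^ α * b ^ (1 - α) = b := by
    rw [← Real.rpow_add hb]; simp
  rcases le_total a b with h | h
  · have h2 : a ^ α ≤ b ^ α := Real.rpow_le_rpow ha h h0.le
    rw [abs_of_nonpos (by linarith), abs_of_nonpos (by linarith)]
    rcases ha.eq_or_lt with rfl | ha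
    · simp [Real.zero_rpow h0.ne']
    have haa : a ^ α * a ^ (1 - α) = a := by
      rw [← Real.rpow_add ha]; simp
    have h3 : a ^ (1 - α) ≤ b ^ (1 - α) := Real.rpow_le_rpow ha.le h (by linarith)
    have h4 : b ^ α * (a ^ α * a ^ (1 - α)) ≤ a ^ α * (b ^ α * b ^ (1 - α)) := by
      have : 0 ≤ a ^ α * b ^ α := by positivity
      nlinarith
    rw [haa, hba] at h4
    nlinarith
  · have ha : 0 < a := lt_of_lt_of_le hb h
    have haa : a ^ α * a ^ (1 - α) = a := by
      rw [← Real.rpow_add ha]; simp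
    have h2 : b ^ α ≤ a ^ α := Real.rpow_le_rpow hb.le h h0.le
    rw [abs_of_nonneg (by linarith), abs_of_nonneg (by linarith)]
    have h3 : b ^ (1 - α) ≤ a ^ (1 - α) := Real.rpow_le_rpow hb.le h (by linarith)
    have h4 : a ^ α * (b ^ α * b ^ (1 - α)) ≤ b ^ α * (a ^ α * a ^ (1 - α)) := by
      have : 0 ≤ a ^ α * b ^ α := by positivity
      nlinarith
    rw [haa, hba] at h4
    nlinarith

lemma swap_aux {α a b : ℝ} (h0 : 0 < α) (h1 : α ≤ 1) (hb : 0 ≤ b) (hab : b ≤ a) :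
    a ^ α * b ≤ b ^ α * a := by
  rcases hb.eq_or_lt with rfl | hb
  · simp [Real.zero_rpow h0.ne']
  have ha : 0 < a := lt_of_lt_of_le hb hab
  have haa : a ^ α * a ^ (1 - α) = a := by
    rw [← Real.rpow_add ha]; simp
  have hba : b ^ α * b ^ (1 - α) = b := by
    rw [← Real.rpow_add hb]; simp
  have h3 : b ^ (1 - α) ≤ a ^ (1 - α) := Real.rpow_le_rpow hb.le hab (by linarith)
  have h4 : a ^ α * (b ^ α * b ^ (1 - α)) ≤ b ^ α * (a ^ α * a ^ (1 - α)) := by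
    have : 0 ≤ a ^ α * b ^ α := by positivity
    nlinarith
  rwa [haa, hba] at h4

lemma fNL_aux {N : ℕ} (hN : 13 ≤ N) (u v : ℂ) (huv : ‖v‖ ≤ ‖u‖) :
    ‖fNL N (u + v) - fNL N u - fNL N v‖ ≤ 4 * (‖u‖ ^ ((8 : ℝ) / ((N : ℝ) - 4)) * ‖v‖) := by
  have hN' : (13 : ℝ) ≤ N := by exact_mod_cast hN
  set α : ℝ := (8 : ℝ) / ((N : ℝ) - 4) with hα
  have h0 : 0 < α := div_pos (by norm_num) (by linarith)
  have h1 : α ≤ 1 := by rw [hα, div_le_one (by linarith)]; linarith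
  have e : fNL N (u + v) - fNL N u - fNL N v
      = Complex.ofReal (‖u + v‖ ^ α) * v + Complex.ofReal (‖u + v‖ ^ α - ‖u‖ ^ α) * u
        - Complex.ofReal (‖v‖ ^ α) * v := by
    simp only [fNL, ← hα]
    push_cast
    ring
  rw [e]
  have n1 : ‖Complex.ofReal (‖u + v‖ ^ α) * v‖ ≤ 2 * (‖u‖ ^ α * ‖v‖) := by
    rw [norm_mul, Complex.norm_real, Real.norm_of_nonneg (by positivity)]
    have : ‖u + v‖ ^ α ≤ 2 * ‖u‖ ^ α := by
      calc ‖u + v‖ ^ α ≤ (2 * ‖u‖) ^ α := by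
            refine Real.rpow_le_rpow (norm_nonneg _) ?_ h0.le
            linarith [norm_add_le u v]
        _ = 2 ^ α * ‖u‖ ^ α := Real.mul_rpow (by norm_num) (norm_nonneg _)
        _ ≤ 2 * ‖u‖ ^ α := by
            refine mul_le_mul_of_nonneg_right ?_ (by positivity)
            calc (2 : ℝ) ^ α ≤ 2 ^ (1 : ℝ) := Real.rpow_le_rpow_of_exponent_le (by norm_num) h1
              _ = 2 := by simp
    nlinarith [norm_nonneg v]
  have n2 : ‖Complex.ofReal (‖u + v‖ ^ α - ‖u‖ ^ α) * u‖ ≤ ‖u‖ ^ α * ‖v‖ := by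
    rw [norm_mul, Complex.norm_real, Real.norm_eq_abs]
    refine (pow_mono_aux h0 h1 (norm_nonneg _) (norm_nonneg _)).trans ?_
    refine mul_le_mul_of_nonneg_left ?_ (by positivity)
    have := abs_norm_sub_norm_le (u + v) u
    simpa using this
  have n3 : ‖Complex.ofReal (‖v‖ ^ α) * v‖ ≤ ‖u‖ ^ α * ‖v‖ := by
    rw [norm_mul, Complex.norm_real, Real.norm_of_nonneg (by positivity)]
    exact mul_le_mul_of_nonneg_right (Real.rpow_le_rpow (norm_nonneg _) huv h0.le) (norm_nonneg _)
  refine (norm_sub_le _ _).trans ?_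
  have := norm_add_le (Complex.ofReal (‖u + v‖ ^ α) * v) (Complex.ofReal (‖u + v‖ ^ α - ‖u‖ ^ α) * u)
  linarith

lemma fNL_bound {N : ℕ} (hN : 13 ≤ N) (u v : ℂ) :
    ‖fNL N (u + v) - fNL N u - fNL N v‖ ≤ 4 * (‖u‖ ^ ((8 : ℝ) / ((N : ℝ) - 4)) * ‖v‖) ∧
    ‖fNL N (u + v) - fNL N u - fNL N v‖ ≤ 4 * (‖v‖ ^ ((8 : ℝ) / ((N : ℝ) - 4)) * ‖u‖) := by
  have hN' : (13 : ℝ) ≤ N := by exact_mod_cast hN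
  have h0 : 0 < (8 : ℝ) / ((N : ℝ) - 4) := div_pos (by norm_num) (by linarith)
  have h1 : (8 : ℝ) / ((N : ℝ) - 4) ≤ 1 := by rw [div_le_one (by linarith)]; linarith
  rcases le_total ‖v‖ ‖u‖ with h | h
  · have h2 := fNL_aux hN u v h
    have h3 := swap_aux h0 h1 (norm_nonneg v) h
    exact ⟨h2, by linarith⟩
  · have h2 := fNL_aux hN v u h
    have h3 := swap_aux h0 h1 (norm_nonneg u) h
    have e : fNL N (u + v) - fNL N u - fNL N v = fNL N (v + u) - fNL N v - fNL N u := by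
      rw [add_comm]; ring
    rw [e]
    exact ⟨by linarith, h2⟩

/-- radial majorant -/
def bb (N : ℕ) (r : ℝ) : ℝ := if r ≤ 1 then (r ^ 6)⁻¹ else (r ^ (N - 6))⁻¹

lemma bb_nonneg (N : ℕ) {r : ℝ} (hr : 0 ≤ r) : 0 ≤ bb N r := by
  unfold bb; split_ifs <;> positivity

lemma bb_meas (N : ℕ) : Measurable (bb N) := by
  unfold bb
  exact Measurable.ite measurableSet_Iic (by fun_prop) (by fun_prop)

lemma bb_int {N : ℕ} (hN : 13 ≤ N) : Integrable (fun x : Rn N => bb N ‖x‖ ^ 2) := by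
  have : Nonempty (Fin N) := ⟨⟨0, by omega⟩⟩
  have : Nontrivial (Rn N) := inferInstance
  have h := integrable_fun_norm_addHaar (volume : Measure (Rn N)) (f := fun r => bb N r ^ 2)
  refine h.2 ?_
  have hd : Module.finrank ℝ (Rn N) = N := by simp
  rw [hd, ← Set.Ioc_union_Ioi_eq_Ioi (zero_le_one' ℝ)]
  refine IntegrableOn.union ?_ ?_
  · have : IntegrableOn (fun r : ℝ => r ^ (N - 13)) (Set.Ioc 0 1) :=
      (Continuous.integrableOn_Icc (by fun_prop)).mono_set Set.Ioc_subset_Icc_self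
    refine this.congr_fun (fun r hr => ?_) measurableSet_Ioc
    have hr0 : r ≠ 0 := hr.1.ne'
    simp only [bb, hr.2, if_true, smul_eq_mul]
    obtain ⟨k, rfl⟩ := Nat.exists_eq_add_of_le hN
    rw [show 13 + k - 13 = k by omega, show 13 + k - 1 = k + 12 by omega]
    field_simp
    ring
  · have : IntegrableOn (fun r : ℝ => r ^ ((11 : ℝ) - N)) (Set.Ioi 1) := by
      refine integrableOn_Ioi_rpow_of_lt ?_ one_pos
      have hN' : (13 : ℝ) ≤ N := by exact_mod_cast hN
      linarith
    refine this.congr_fun (fun r hr => ?_) measurableSet_Ioi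
    have hr1 : (1 : ℝ) < r := hr
    have hr0 : 0 < r := by linarith
    simp only [bb, not_le.2 hr1, if_false, smul_eq_mul]
    obtain ⟨k, rfl⟩ := Nat.exists_eq_add_of_le hN
    rw [show 13 + k - 6 = k + 7 by omega, show 13 + k - 1 = k + 12 by omega]
    have e : (11 : ℝ) - ((13 + k : ℕ) : ℝ) = -((k + 2 : ℕ) : ℝ) := by push_cast; ring
    rw [e, Real.rpow_neg hr0.le, Real.rpow_natCast]
    field_simp
    ring

lemma bb_scale {N : ℕ} (hN : 13 ≤ N) {R : ℝ} (hR : 0 < R) :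
    Integrable (fun x : Rn N => bb N ‖R⁻¹ • x‖ ^ 2) ∧
    ∫ x : Rn N, bb N ‖R⁻¹ • x‖ ^ 2 = R ^ N * ∫ x : Rn N, bb N ‖x‖ ^ 2 := by
  constructor
  · exact (bb_int hN).comp_smul (inv_ne_zero hR.ne')
  · have := Measure.integral_comp_inv_smul (volume : Measure (Rn N)) (fun x => bb N ‖x‖ ^ 2) R
    rw [this]
    simp [abs_of_pos hR]

lemma cs_aux {N : ℕ} {φ ψ : Rn N → ℝ} (hφ : AEStronglyMeasurable φ) (hψ : AEStronglyMeasurable ψ)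
    (h0φ : ∀ x, 0 ≤ φ x) (h0ψ : ∀ x, 0 ≤ ψ x)
    (iφ : Integrable (fun x => φ x ^ 2)) (iψ : Integrable (fun x => ψ x ^ 2)) :
    Integrable (fun x => φ x * ψ x) ∧
    ∫ x, φ x * ψ x ≤ Real.sqrt (∫ x, φ x ^ 2) * Real.sqrt (∫ x, ψ x ^ 2) := by
  have m1 : MemLp φ 2 := (memLp_two_iff_integrable_sq hφ).2 iφ
  have m2 : MemLp ψ 2 := (memLp_two_iff_integrable_sq hψ).2 iψ
  refine ⟨m1.integrable_mul m2, ?_⟩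
  have := integral_mul_le_Lp_mul_Lq_of_nonneg (μ := (volume : Measure (Rn N))) (p := 2) (q := 2)
    (Real.HolderConjugate.two_two) (Filter.Eventually.of_forall h0φ)
    (Filter.Eventually.of_forall h0ψ) (by simpa using m1) (by simpa using m2)
  rw [Real.sqrt_eq_rpow, Real.sqrt_eq_rpow]
  simpa using this

/-- Rellich + Cauchy-Schwarz -/
lemma main_est {N : ℕ} (hN : 13 ≤ N) {lam D : ℝ} (hl : 0 < lam) (hD : 0 ≤ D) (g : 𝓢(Rn N, ℂ))
    (h : Rn N → ℂ)
    (hb : ∀ x, x ≠ 0 → ‖h x‖ ≤ D * lam * bb N ‖(Real.sqrt lam)⁻¹ • x‖ * qf lam (-1) x) :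
    |(∫ x, h x * g x).re| ≤ D * Real.sqrt (∫ x : Rn N, bb N ‖x‖ ^ 2) * lam ^ (((N : ℝ) + 4) / 4)
      * Real.sqrt (∫ x : Rn N, ‖lapC (⇑g) x‖ ^ 2) := by
  have : Nonempty (Fin N) := ⟨⟨0, by omega⟩⟩
  have : Nontrivial (Rn N) := inferInstance
  set R := Real.sqrt lam with hR
  have hRp : 0 < R := Real.sqrt_pos.2 hl
  obtain ⟨r1, r2⟩ := rellich hN hl g
  obtain ⟨s1, s2⟩ := bb_scale hN hRp
  have hsq : ∀ x : Rn N, (qf lam (-1) x * ‖g x‖) ^ 2 = qf lam (-2) x * ‖g x‖ ^ 2 := fun x => by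
    unfold qf
    rw [mul_pow, ← Real.rpow_mul_natCast (base_pos hl x).le]
    norm_num
  have hqc : Continuous (qf (N := N) lam (-1)) := (qf_contDiff hl (-1)).continuous
  obtain ⟨c1, c2⟩ := cs_aux (N := N) (φ := fun x => bb N ‖R⁻¹ • x‖)
    (ψ := fun x => qf lam (-1) x * ‖g x‖)
    (((bb_meas N).comp (by fun_prop)).aestronglyMeasurable)
    ((hqc.mul g.continuous.norm).aestronglyMeasurable)
    (fun x => bb_nonneg N (norm_nonneg _))
    (fun x => mul_nonneg (qf_pos hl _ x).le (norm_nonneg _)) s1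
    (by simpa only [hsq] using r1)
  simp only [hsq] at c2
  calc |(∫ x, h x * g x).re| ≤ ‖∫ x, h x * g x‖ := Complex.abs_re_le_norm _
    _ ≤ ∫ x, ‖h x * g x‖ := norm_integral_le_integral_norm _
    _ ≤ ∫ x, D * lam * (bb N ‖R⁻¹ • x‖ * (qf lam (-1) x * ‖g x‖)) := by
        refine integral_mono_of_nonneg (Filter.Eventually.of_forall fun x => norm_nonneg _)
          (c1.const_mul _) ?_
        have hne : ∀ᵐ x : Rn N, x ≠ 0 := by
          rw [ae_iff]; simp
        filter_upwards [hne] with x hx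
        rw [norm_mul]
        have := mul_le_mul_of_nonneg_right (hb x hx) (norm_nonneg (g x))
        linarith
    _ = D * lam * ∫ x, (bb N ‖R⁻¹ • x‖ * (qf lam (-1) x * ‖g x‖)) := integral_const_mul _ _
    _ ≤ D * lam * (Real.sqrt (R ^ N * ∫ x : Rn N, bb N ‖x‖ ^ 2)
          * Real.sqrt (∫ x : Rn N, ‖lapC (⇑g) x‖ ^ 2)) := by
        refine mul_le_mul_of_nonneg_left ?_ (by positivity)
        refine c2.trans ?_
        rw [s2]
        exact mul_le_mul_of_nonneg_left (Real.sqrt_le_sqrt r2) (Real.sqrt_nonneg _)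
    _ = _ := by
        rw [Real.sqrt_mul (by positivity)]
        have e : lam ^ (((N : ℝ) + 4) / 4) = lam * Real.sqrt (R ^ N) := by
          rw [hR, Real.sqrt_eq_rpow, Real.sqrt_eq_rpow, ← Real.rpow_mul_natCast hl.le,
            ← Real.rpow_mul hl.le]
          nth_rewrite 2 [← Real.rpow_one lam]
          rw [← Real.rpow_add hl]
          congr 1
          ring
        rw [e]
        ring

/-- the exponent -/
abbrev mm (N : ℕ) : ℝ := ((N : ℝ) - 4) / 2
abbrev KK (N : ℕ) : ℝ := (N : ℝ) * ((N : ℝ) - 4) * ((N : ℝ) ^ 2 - 4)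
abbrev CC (N : ℕ) : ℝ := KK N ^ (((N : ℝ) - 4) / 8)

lemma KK_pos {N : ℕ} (hN : 13 ≤ N) : 0 < KK N := by
  have hN' : (13 : ℝ) ≤ N := by exact_mod_cast hN
  have : (0 : ℝ) < N - 4 := by linarith
  have : (0 : ℝ) < N ^ 2 - 4 := by nlinarith
  positivity

lemma CC_pos {N : ℕ} (hN : 13 ≤ N) : 0 < CC N := Real.rpow_pos_of_pos (KK_pos hN) _

lemma resc_eq {N : ℕ} {a : ℝ} (ha : 0 < a) (x : Rn N) :
    rescR a (Wfun N) x = (CC N * a ^ (mm N)) * qf a (-(mm N)) x := by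
  rw [qf_eq ha]
  simp only [rescR, Wfun]
  have : a ^ (mm N) * (a ^ 2) ^ (-(mm N)) = a ^ (-(mm N)) := by
    rw [← Real.rpow_natCast a 2, ← Real.rpow_mul ha.le, ← Real.rpow_add ha]
    congr 1; push_cast; ring
  calc _ = a ^ (-(mm N)) * (CC N * (1 + ‖a⁻¹ • x‖ ^ 2) ^ (-(mm N))) := rfl
    _ = _ := by rw [← this]; ring

lemma resc_pos {N : ℕ} (hN : 13 ≤ N) {a : ℝ} (ha : 0 < a) (x : Rn N) : 0 < rescR a (Wfun N) x := by
  rw [resc_eq ha]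
  have := CC_pos hN
  have := qf_pos ha (-(mm N)) x
  positivity

lemma resc_pow {N : ℕ} (hN : 13 ≤ N) {a : ℝ} (ha : 0 < a) (x : Rn N) :
    (rescR a (Wfun N) x) ^ ((8 : ℝ) / ((N : ℝ) - 4)) = KK N * a ^ 4 * qf a (-4) x := by
  have hN' : (13 : ℝ) ≤ N := by exact_mod_cast hN
  have h4 : (N : ℝ) - 4 ≠ 0 := by linarith
  have hK := KK_pos hN
  have hC := CC_pos hN
  rw [resc_eq ha, Real.mul_rpow (by positivity) (qf_pos ha _ x).le,
    Real.mul_rpow hC.le (by positivity), ← Real.rpow_mul hK.le, ← Real.rpow_mul ha.le, qf,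
    ← Real.rpow_mul (base_pos ha x).le, qf]
  have e1 : ((N : ℝ) - 4) / 8 * (8 / ((N : ℝ) - 4)) = 1 := by field_simp
  have e2 : mm N * (8 / ((N : ℝ) - 4)) = 4 := by simp only [mm]; field_simp; norm_num
  rw [e1, e2, neg_mul, e2, Real.rpow_one]
  congr 2
  exact_mod_cast Real.rpow_natCast a 4

lemma dbl {N : ℕ} {a : ℝ} (ha : 0 < a) (G : 𝓢(Rn N, ℂ)) :
    Integrable (fun x => qL a (-(mm N)) x • (Δ G : 𝓢(Rn N, ℂ)) x) ∧
    Integrable (fun x => (KK N * a ^ 4 * qf a (-(mm N) - 4) x) • G x) ∧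
    ∫ x, qL a (-(mm N)) x • (Δ G : 𝓢(Rn N, ℂ)) x
      = ∫ x, (KK N * a ^ 4 * qf a (-(mm N) - 4) x) • G x := by
  set s : ℝ := -(mm N) with hs
  have hNs : (N : ℝ) = 4 - 2 * s := by rw [hs, mm]; ring
  set c1 : ℝ := 2 * s * N + 4 * s * (s - 1) with hc1
  set c2 : ℝ := 4 * a ^ 2 * s * (s - 1) with hc2
  have i1 := temp_int (qf_temperate ha (s - 1)) (Δ G : 𝓢(Rn N, ℂ))
  have i2 := temp_int (qf_temperate ha (s - 2)) (Δ G : 𝓢(Rn N, ℂ))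
  have hqL : ∀ t : ℝ, (qL (N := N) a t).HasTemperateGrowth := fun t =>
    ((Function.HasTemperateGrowth.const _).mul (qf_temperate ha _)).sub
      ((Function.HasTemperateGrowth.const _).mul (qf_temperate ha _))
  have j1 := temp_int (hqL (s - 1)) G
  have j2 := temp_int (hqL (s - 2)) G
  refine ⟨temp_int (hqL s) _, temp_int ((Function.HasTemperateGrowth.const _).mul
    (qf_temperate ha _)) G, ?_⟩
  have e1 : ∀ x, qL a s x • (Δ G : 𝓢(Rn N, ℂ)) x
      = c1 • (qf a (s - 1) x • (Δ G : 𝓢(Rn N, ℂ)) x) - c2 • (qf a (s - 2) x • (Δ G : 𝓢(Rn N, ℂ)) x) := by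
    intro x
    rw [smul_smul, smul_smul, ← sub_smul]
    rfl
  have e2 : ∀ x, (KK N * a ^ 4 * qf a (s - 4) x) • G x
      = c1 • (qL a (s - 1) x • G x) - c2 • (qL a (s - 2) x • G x) := by
    intro x
    rw [smul_smul, smul_smul, ← sub_smul]
    congr 1
    simp only [qL, KK]
    rw [show s - 1 - 1 = s - 2 by ring, show s - 1 - 2 = s - 3 by ring,
      show s - 2 - 1 = s - 3 by ring, show s - 2 - 2 = s - 4 by ring, hc1, hc2, hNs]
    ring
  simp only [e1, e2]
  have i1' : Integrable (fun x => c1 • (qf a (s - 1) x • (Δ G : 𝓢(Rn N, ℂ)) x)) := i1.smul c1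
  have i2' : Integrable (fun x => c2 • (qf a (s - 2) x • (Δ G : 𝓢(Rn N, ℂ)) x)) := i2.smul c2
  have j1' : Integrable (fun x => c1 • (qL a (s - 1) x • G x)) := j1.smul c1
  have j2' : Integrable (fun x => c2 • (qL a (s - 2) x • G x)) := j2.smul c2
  rw [integral_sub i1' i2', integral_sub j1' j2',
    integral_smul, integral_smul, integral_smul, integral_smul, ibp_q ha, ibp_q ha]

lemma cexp_norm (t : ℝ) : ‖cexp t‖ = 1 := by
  unfold cexp
  rw [mul_comm]
  exact Complex.norm_exp_ofReal_mul_I t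

lemma fNL_resc {N : ℕ} (hN : 13 ≤ N) {a : ℝ} (ha : 0 < a) (t : ℝ) (x : Rn N) :
    fNL N (cexp t * (rescR a (Wfun N) x : ℂ))
      = cexp t * ((CC N * a ^ (mm N) : ℝ) : ℂ) * ((KK N * a ^ 4 * qf a (-(mm N) - 4) x : ℝ) : ℂ) := by
  have hp := resc_pos hN ha x
  have hq : qf a (-(mm N) - 4) x = qf a (-(mm N)) x * qf a (-4) x := by
    unfold qf
    rw [← Real.rpow_add (base_pos ha x)]
    rfl
  rw [fNL, norm_mul, cexp_norm, one_mul, Complex.norm_real, Real.norm_of_nonneg hp.le,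
    resc_pow hN ha, resc_eq ha, hq]
  push_cast
  ring

lemma fNL_cont {N : ℕ} (hN : 13 ≤ N) : Continuous (fNL N) := by
  have hN' : (13 : ℝ) ≤ N := by exact_mod_cast hN
  have h0 : 0 ≤ (8 : ℝ) / ((N : ℝ) - 4) := div_nonneg (by norm_num) (by linarith)
  exact (Complex.continuous_ofReal.comp (continuous_norm.rpow_const fun _ => Or.inr h0)).mul
    continuous_id

lemma qf_le {N : ℕ} {a : ℝ} (ha : 0 < a) {x : Rn N} (hx : x ≠ 0) (k : ℕ) :
    qf a (-((k : ℝ) / 2)) x ≤ (‖x‖ ^ k)⁻¹ := by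
  have hx' : 0 < ‖x‖ := norm_pos_iff.2 hx
  have e : (‖x‖ ^ k)⁻¹ = (‖x‖ ^ 2) ^ (-((k : ℝ) / 2)) := by
    rw [← Real.rpow_natCast ‖x‖ 2, ← Real.rpow_mul hx'.le, ← Real.rpow_natCast, ← Real.rpow_neg hx'.le]
    congr 1; push_cast; ring
  rw [e, qf]
  refine Real.rpow_le_rpow_of_nonpos (by positivity) (by nlinarith) ?_
  have : (0 : ℝ) ≤ k := Nat.cast_nonneg k
  linarith

/-- pointwise bound of the interaction -/
lemma h_bound {N : ℕ} (hN : 13 ≤ N) {M E : ℝ} (hM : 0 ≤ M) (hE : M ≤ E)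
    (hE' : M ^ ((8 : ℝ) / ((N : ℝ) - 4)) ≤ E) {lam : ℝ} (hl : 0 < lam) (ζ' : ℂ) (θ : ℝ)
    (hζ : ‖ζ'‖ ≤ M) (x : Rn N) (hx : x ≠ 0) :
    ‖fNL N (ζ' + cexp θ * (rescR lam (Wfun N) x : ℂ)) - fNL N ζ'
      - fNL N (cexp θ * (rescR lam (Wfun N) x : ℂ))‖
      ≤ (4 * E * (CC N + KK N)) * lam * bb N ‖(Real.sqrt lam)⁻¹ • x‖ * qf lam (-1) x := by
  have hN' : (13 : ℝ) ≤ N := by exact_mod_cast hN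
  have h0 : 0 ≤ (8 : ℝ) / ((N : ℝ) - 4) := div_nonneg (by norm_num) (by linarith)
  have hC := CC_pos hN
  have hK := KK_pos hN
  have hE0 : 0 ≤ E := hM.trans hE
  have hp := resc_pos hN hl x
  have hx' : 0 < ‖x‖ := norm_pos_iff.2 hx
  set R := Real.sqrt lam with hR
  have hRp : 0 < R := Real.sqrt_pos.2 hl
  have hRl : R ^ 2 = lam := Real.sq_sqrt hl.le
  obtain ⟨b1, b2⟩ := fNL_bound hN ζ' (cexp θ * (rescR lam (Wfun N) x : ℂ))
  have hv : ‖cexp θ * (rescR lam (Wfun N) x : ℂ)‖ = rescR lam (Wfun N) x := by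
    rw [norm_mul, cexp_norm, one_mul, Complex.norm_real, Real.norm_of_nonneg hp.le]
  rw [hv] at b1 b2
  rw [resc_pow hN hl] at b2
  have hq1 := qf_pos hl (-1) x
  have hnorm : ‖R⁻¹ • x‖ = R⁻¹ * ‖x‖ := by
    rw [norm_smul, norm_inv, Real.norm_of_nonneg hRp.le]
  unfold bb
  split_ifs with hc
  · refine b2.trans ?_
    have hq : qf lam (-4) x = qf lam (-3) x * qf lam (-1) x := by
      unfold qf
      rw [← Real.rpow_add (base_pos hl x)]
      norm_num
    have hq3 : qf lam (-3) x ≤ (‖x‖ ^ 6)⁻¹ := by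
      have := qf_le hl hx 6
      norm_num at this ⊢
      exact this
    have e : lam * (‖R⁻¹ • x‖ ^ 6)⁻¹ = lam ^ 4 * (‖x‖ ^ 6)⁻¹ := by
      rw [hnorm, ← hRl]
      field_simp
    have h5 : 0 < qf lam (-3) x := qf_pos hl _ x
    calc 4 * (KK N * lam ^ 4 * qf lam (-4) x * ‖ζ'‖)
        ≤ 4 * (KK N * lam ^ 4 * ((‖x‖ ^ 6)⁻¹ * qf lam (-1) x) * E) := by
          rw [hq]
          gcongr
          exact hζ.trans hE
      _ = 4 * E * KK N * (lam ^ 4 * (‖x‖ ^ 6)⁻¹) * qf lam (-1) x := by ring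
      _ ≤ 4 * E * (CC N + KK N) * (lam ^ 4 * (‖x‖ ^ 6)⁻¹) * qf lam (-1) x := by
          gcongr
          linarith
      _ = _ := by rw [← e]; ring
  · refine b1.trans ?_
    obtain ⟨k, hk⟩ : ∃ k, N = k + 6 := ⟨N - 6, by omega⟩
    have hkm : mm N = (k : ℝ) / 2 + 1 := by rw [mm, hk]; push_cast; ring
    have hNk : N - 6 = k := by omega
    have hq : qf lam (-(mm N)) x = qf lam (-((k : ℝ) / 2)) x * qf lam (-1) x := by
      unfold qf
      rw [← Real.rpow_add (base_pos hl x), hkm]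
      congr 1; ring
    have hq3 := qf_le hl hx k
    have e : lam * (‖R⁻¹ • x‖ ^ k)⁻¹ = lam ^ (mm N) * (‖x‖ ^ k)⁻¹ := by
      rw [hnorm, mul_pow, mul_inv, inv_pow, inv_inv, hkm, Real.rpow_add hl, Real.rpow_one]
      have : lam ^ ((k : ℝ) / 2) = R ^ k := by
        rw [hR, Real.sqrt_eq_rpow, ← Real.rpow_mul_natCast hl.le]
        congr 1; ring
      rw [this]; ring
    have h5 : 0 < qf lam (-((k : ℝ) / 2)) x := qf_pos hl _ x
    have h6 : ‖ζ'‖ ^ ((8 : ℝ) / ((N : ℝ) - 4)) ≤ E :=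
      (Real.rpow_le_rpow (norm_nonneg _) hζ h0).trans hE'
    rw [hNk]
    calc 4 * (‖ζ'‖ ^ ((8 : ℝ) / ((N : ℝ) - 4)) * rescR lam (Wfun N) x)
        ≤ 4 * (E * (CC N * lam ^ (mm N) * ((‖x‖ ^ k)⁻¹ * qf lam (-1) x))) := by
          rw [resc_eq hl, hq]
          gcongr
      _ = 4 * E * CC N * (lam ^ (mm N) * (‖x‖ ^ k)⁻¹) * qf lam (-1) x := by ring
      _ ≤ 4 * E * (CC N + KK N) * (lam ^ (mm N) * (‖x‖ ^ k)⁻¹) * qf lam (-1) x := by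
          gcongr
          linarith
      _ = _ := by rw [← e]; ring

lemma resc_le {N : ℕ} (hN : 13 ≤ N) {a : ℝ} (ha : 0 < a) (x : Rn N) :
    rescR a (Wfun N) x ≤ CC N * a ^ (-(mm N)) := by
  have hN' : (13 : ℝ) ≤ N := by exact_mod_cast hN
  have hC := CC_pos hN
  have : (1 + ‖a⁻¹ • x‖ ^ 2) ^ (-(mm N)) ≤ 1 :=
    Real.rpow_le_one_of_one_le_of_nonpos (by nlinarith [norm_nonneg (a⁻¹ • x)])
      (by simp only [mm]; linarith)
  calc rescR a (Wfun N) x = a ^ (-(mm N)) * (CC N * (1 + ‖a⁻¹ • x‖ ^ 2) ^ (-(mm N))) := rfl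
    _ ≤ a ^ (-(mm N)) * (CC N * 1) := by gcongr
    _ = _ := by ring

lemma resc_cont {N : ℕ} {a : ℝ} (ha : 0 < a) : Continuous (rescR a (Wfun N)) := by
  rw [funext (resc_eq ha)]
  exact continuous_const.mul (qf_contDiff ha _).continuous

lemma fNL_V_int {N : ℕ} (hN : 13 ≤ N) {μ lam : ℝ} (hμ : 0 < μ) (hl : 0 < lam) (ζ θ : ℝ)
    (g : 𝓢(Rn N, ℂ)) :
    Integrable (fun x => (starRingEnd ℂ) (fNL N (cexp ζ * (rescR μ (Wfun N) x : ℂ)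
      + cexp θ * (rescR lam (Wfun N) x : ℂ))) * g x) := by
  have hN' : (13 : ℝ) ≤ N := by exact_mod_cast hN
  have h0 : 0 ≤ (8 : ℝ) / ((N : ℝ) - 4) := div_nonneg (by norm_num) (by linarith)
  set T : ℝ := CC N * μ ^ (-(mm N)) + CC N * lam ^ (-(mm N)) with hT
  have hb : ∀ x, ‖cexp ζ * (rescR μ (Wfun N) x : ℂ) + cexp θ * (rescR lam (Wfun N) x : ℂ)‖ ≤ T := by
    intro x
    refine (norm_add_le _ _).trans ?_
    rw [norm_mul, cexp_norm, one_mul, Complex.norm_real, Real.norm_of_nonneg (resc_pos hN hμ x).le,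
      norm_mul, cexp_norm, one_mul, Complex.norm_real, Real.norm_of_nonneg (resc_pos hN hl x).le]
    exact add_le_add (resc_le hN hμ x) (resc_le hN hl x)
  refine g.integrable.bdd_mul (c := T ^ ((8 : ℝ) / ((N : ℝ) - 4)) * T) ?_
    (Filter.Eventually.of_forall fun x => ?_)
  · refine Continuous.aestronglyMeasurable ?_
    refine Complex.continuous_conj.comp ((fNL_cont hN).comp ?_)
    exact (continuous_const.mul (Complex.continuous_ofReal.comp (resc_cont hμ))).add
      (continuous_const.mul (Complex.continuous_ofReal.comp (resc_cont hl)))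
  · rw [RCLike.norm_conj, fNL, norm_mul, Complex.norm_real, Real.norm_of_nonneg (by positivity)]
    have := (norm_nonneg _).trans (hb x)
    gcongr
    · exact hb x
    · exact hb x

theorem stmt_11 (N : ℕ) (hN : 13 ≤ N) :
    ∃ η C : ℝ, 0 < η ∧ 0 < C ∧
      ∀ ζ θ μ lam : ℝ, 0 < μ → 0 < lam →
        |ζ + Real.pi / 2| + |μ - 1| + |θ| + lam ≤ η →
        ∀ g : SchwartzMap (Rn N) ℂ,
          |(∫ x : Rn N,
                (starRingEnd ℂ)
                    (lapC (fun y : Rn N =>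
                      cexp ζ * (rescR μ (Wfun N) y : ℂ) + cexp θ * (rescR lam (Wfun N) y : ℂ)) x)
                  * lapC (⇑g) x).re
            - (∫ x : Rn N,
                (starRingEnd ℂ)
                    (fNL N (cexp ζ * (rescR μ (Wfun N) x : ℂ) + cexp θ * (rescR lam (Wfun N) x : ℂ)))
                  * g x).re|
          ≤ C * lam ^ (((N : ℝ) + 4) / 4) * Real.sqrt (∫ x : Rn N, ‖lapC (⇑g) x‖ ^ 2) := by
  have hC := CC_pos hN
  have hK := KK_pos hN
  set M : ℝ := CC N * (1 / 2 : ℝ) ^ (-(mm N)) with hM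
  have hM0 : 0 ≤ M := by positivity
  set E : ℝ := M + M ^ ((8 : ℝ) / ((N : ℝ) - 4)) with hE
  have hM8 : 0 ≤ M ^ ((8 : ℝ) / ((N : ℝ) - 4)) := by positivity
  have hE0 : 0 ≤ E := by positivity
  set D : ℝ := 4 * E * (CC N + KK N) with hD
  have hD0 : 0 ≤ D := by positivity
  refine ⟨1 / 2, D * Real.sqrt (∫ x : Rn N, bb N ‖x‖ ^ 2) + 1, by norm_num, by positivity, ?_⟩
  intro ζ θ μ lam hμ hl hη g
  have hN' : (13 : ℝ) ≤ N := by exact_mod_cast hN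
  have hμ2 : 1 / 2 ≤ μ := by
    have h1 := abs_nonneg (ζ + Real.pi / 2)
    have h2 := abs_nonneg θ
    have h3 := neg_abs_le (μ - 1)
    linarith
  have hu : ∀ x : Rn N, ‖cexp ζ * (rescR μ (Wfun N) x : ℂ)‖ ≤ M := by
    intro x
    rw [norm_mul, cexp_norm, one_mul, Complex.norm_real, Real.norm_of_nonneg (resc_pos hN hμ x).le]
    refine (resc_le hN hμ x).trans ?_
    refine mul_le_mul_of_nonneg_left ?_ hC.le
    exact Real.rpow_le_rpow_of_nonpos (by norm_num) hμ2 (by simp only [mm]; linarith)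
  -- the linear part
  have hlin : ∀ (a t : ℝ) (ha : 0 < a),
      Integrable (fun x : Rn N => (starRingEnd ℂ) (fNL N (cexp t * (rescR a (Wfun N) x : ℂ))) * g x) ∧
      Integrable (fun x : Rn N => (starRingEnd ℂ) (cexp t * ((CC N * a ^ (mm N) : ℝ) : ℂ)
        * (qL a (-(mm N)) x : ℂ)) * lapC (⇑g) x) ∧
      ∫ x : Rn N, (starRingEnd ℂ) (cexp t * ((CC N * a ^ (mm N) : ℝ) : ℂ)
        * (qL a (-(mm N)) x : ℂ)) * lapC (⇑g) x
      = ∫ x : Rn N, (starRingEnd ℂ) (fNL N (cexp t * (rescR a (Wfun N) x : ℂ))) * g x := by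
    intro a t ha
    obtain ⟨i1, i2, i3⟩ := dbl ha g
    set A : ℂ := (starRingEnd ℂ) (cexp t * ((CC N * a ^ (mm N) : ℝ) : ℂ)) with hA
    have f1 : ∀ x : Rn N, (starRingEnd ℂ) (cexp t * ((CC N * a ^ (mm N) : ℝ) : ℂ)
        * (qL a (-(mm N)) x : ℂ)) * lapC (⇑g) x
        = A * (qL a (-(mm N)) x • (Δ g : 𝓢(Rn N, ℂ)) x) := by
      intro x
      rw [map_mul, Complex.conj_ofReal, lapC_schwartz, Complex.real_smul, mul_assoc]
    have f2 : ∀ x : Rn N, (starRingEnd ℂ) (fNL N (cexp t * (rescR a (Wfun N) x : ℂ))) * g x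
        = A * ((KK N * a ^ 4 * qf a (-(mm N) - 4) x) • g x) := by
      intro x
      rw [fNL_resc hN ha, map_mul, Complex.conj_ofReal, Complex.real_smul, mul_assoc]
    simp only [f1, f2]
    refine ⟨i2.const_mul A, i1.const_mul A, ?_⟩
    rw [integral_const_mul, integral_const_mul, i3]
  obtain ⟨u1, u2, u3⟩ := hlin μ ζ hμ
  obtain ⟨v1, v2, v3⟩ := hlin lam θ hl
  have hV : ∀ x : Rn N, (starRingEnd ℂ) (lapC (fun y : Rn N =>
      cexp ζ * (rescR μ (Wfun N) y : ℂ) + cexp θ * (rescR lam (Wfun N) y : ℂ)) x) * lapC (⇑g) x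
      = (starRingEnd ℂ) (cexp ζ * ((CC N * μ ^ (mm N) : ℝ) : ℂ)
        * (qL μ (-(mm N)) x : ℂ)) * lapC (⇑g) x + (starRingEnd ℂ) (cexp θ * ((CC N * lam ^ (mm N) : ℝ) : ℂ)
        * (qL lam (-(mm N)) x : ℂ)) * lapC (⇑g) x := by
    intro x
    have e : (fun y : Rn N =>
        cexp ζ * (rescR μ (Wfun N) y : ℂ) + cexp θ * (rescR lam (Wfun N) y : ℂ))
        = fun y : Rn N => (cexp ζ * ((CC N * μ ^ (mm N) : ℝ) : ℂ)) * (qf μ (-(mm N)) y : ℂ)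
          + (cexp θ * ((CC N * lam ^ (mm N) : ℝ) : ℂ)) * (qf lam (-(mm N)) y : ℂ) := by
      ext y
      rw [resc_eq hμ, resc_eq hl]
      push_cast
      ring
    rw [e, lapC_comb hμ hl, map_add, add_mul]
  simp only [hV]
  have hI := fNL_V_int hN hμ hl ζ θ g
  have huv : Integrable (fun x : Rn N =>
      (starRingEnd ℂ) (fNL N (cexp ζ * (rescR μ (Wfun N) x : ℂ))) * g x
        + (starRingEnd ℂ) (fNL N (cexp θ * (rescR lam (Wfun N) x : ℂ))) * g x) := u1.add v1
  rw [integral_add u2 v2, u3, v3, ← integral_add u1 v1, ← Complex.sub_re,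
    ← integral_sub huv hI]
  have hmain := main_est hN hl hD0 g (fun x => (starRingEnd ℂ)
    (-(fNL N (cexp ζ * (rescR μ (Wfun N) x : ℂ) + cexp θ * (rescR lam (Wfun N) x : ℂ))
      - fNL N (cexp ζ * (rescR μ (Wfun N) x : ℂ)) - fNL N (cexp θ * (rescR lam (Wfun N) x : ℂ)))))
    (fun x hx => by
      rw [RCLike.norm_conj, norm_neg]
      exact h_bound hN hM0 (by linarith) (by linarith) hl _ θ (hu x) x hx)
  have hcongr : ∀ x : Rn N, (starRingEnd ℂ)
      (-(fNL N (cexp ζ * (rescR μ (Wfun N) x : ℂ) + cexp θ * (rescR lam (Wfun N) x : ℂ))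
      - fNL N (cexp ζ * (rescR μ (Wfun N) x : ℂ)) - fNL N (cexp θ * (rescR lam (Wfun N) x : ℂ)))) * g x
      = (starRingEnd ℂ) (fNL N (cexp ζ * (rescR μ (Wfun N) x : ℂ))) * g x
        + (starRingEnd ℂ) (fNL N (cexp θ * (rescR lam (Wfun N) x : ℂ))) * g x
        - (starRingEnd ℂ) (fNL N (cexp ζ * (rescR μ (Wfun N) x : ℂ)
          + cexp θ * (rescR lam (Wfun N) x : ℂ))) * g x := by
    intro x
    simp only [map_neg, map_sub]
    ring
  simp only [hcongr] at hmain
  refine hmain.trans ?_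
  have : 0 ≤ lam ^ (((N : ℝ) + 4) / 4) * Real.sqrt (∫ x : Rn N, ‖lapC (⇑g) x‖ ^ 2) := by positivity
  nlinarith
end
end

section
/- There exist constants c > 0 and C > 0 such that for every real-valued radially symmetric Schwartz function g on ℝ^N, one has ∫_{ℝ^N} |Δg|² dx − ∫_{ℝ^N} W^{8/(N−4)}·g² dx ≥ c·∫_{ℝ^N} |Δg|² dx − C·(∫_{ℝ^N} ΛW·g dx)². -/
open MeasureTheory

noncomputable section

section Aux

open MeasureTheory Set Filter Topology

/-- rapidly decreasing on the half line -/
def Rap (h : ℝ → ℝ) : Prop :=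
  ContinuousOn h (Ici 0) ∧ ∀ k : ℕ, ∃ C : ℝ, ∀ r : ℝ, 0 ≤ r → (1 + r) ^ k * |h r| ≤ C

/-- polynomially growing on the half line -/
def Slow (m : ℝ → ℝ) : Prop :=
  ContinuousOn m (Ici 0) ∧ ∃ k : ℕ, ∃ C : ℝ, ∀ r : ℝ, 0 ≤ r → |m r| ≤ C * (1 + r) ^ k

lemma Rap.slow {h : ℝ → ℝ} (hh : Rap h) : Slow h := by
  obtain ⟨C, hC⟩ := hh.2 0
  exact ⟨hh.1, 0, C, fun r hr => by simpa using hC r hr⟩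

lemma Rap.mul_slow {h m : ℝ → ℝ} (hh : Rap h) (hm : Slow m) : Rap (fun r => m r * h r) := by
  refine ⟨hm.1.mul hh.1, fun k => ?_⟩
  obtain ⟨j, C, hC⟩ := hm.2
  obtain ⟨D, hD⟩ := hh.2 (k + j)
  have hC0 : 0 ≤ C := by
    have := hC 0 le_rfl
    simp at this
    exact (abs_nonneg _).trans this
  refine ⟨C * D, fun r hr => ?_⟩
  rw [abs_mul]
  calc (1 + r) ^ k * (|m r| * |h r|) ≤ (1 + r) ^ k * ((C * (1 + r) ^ j) * |h r|) := by
        gcongr; exact hC r hr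
    _ = C * ((1 + r) ^ (k + j) * |h r|) := by ring
    _ ≤ C * D := by gcongr; exact hD r hr

lemma Rap.add {h m : ℝ → ℝ} (hh : Rap h) (hm : Rap m) : Rap (fun r => h r + m r) := by
  refine ⟨hh.1.add hm.1, fun k => ?_⟩
  obtain ⟨C, hC⟩ := hh.2 k
  obtain ⟨D, hD⟩ := hm.2 k
  refine ⟨C + D, fun r hr => ?_⟩
  calc (1 + r) ^ k * |h r + m r| ≤ (1 + r) ^ k * (|h r| + |m r|) := by
        gcongr; exact abs_add_le _ _
    _ = (1 + r) ^ k * |h r| + (1 + r) ^ k * |m r| := by ring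
    _ ≤ C + D := add_le_add (hC r hr) (hD r hr)

lemma Slow.add {h m : ℝ → ℝ} (hh : Slow h) (hm : Slow m) : Slow (fun r => h r + m r) := by
  obtain ⟨j, C, hC⟩ := hh.2
  obtain ⟨k, D, hD⟩ := hm.2
  have hC0 : 0 ≤ C := by
    have := hC 0 le_rfl
    simp at this
    exact (abs_nonneg _).trans this
  have hD0 : 0 ≤ D := by
    have := hD 0 le_rfl
    simp at this
    exact (abs_nonneg _).trans this
  refine ⟨hh.1.add hm.1, j + k, C + D, fun r hr => ?_⟩
  have h1 : (1 + r) ^ j ≤ (1 + r) ^ (j + k) := pow_le_pow_right₀ (by linarith) (by omega)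
  have h2 : (1 + r) ^ k ≤ (1 + r) ^ (j + k) := pow_le_pow_right₀ (by linarith) (by omega)
  calc |h r + m r| ≤ |h r| + |m r| := abs_add_le _ _
    _ ≤ C * (1 + r) ^ j + D * (1 + r) ^ k := add_le_add (hC r hr) (hD r hr)
    _ ≤ C * (1 + r) ^ (j + k) + D * (1 + r) ^ (j + k) := by gcongr
    _ = _ := by ring

lemma Slow.mul {h m : ℝ → ℝ} (hh : Slow h) (hm : Slow m) : Slow (fun r => h r * m r) := by
  obtain ⟨j, C, hC⟩ := hh.2
  obtain ⟨k, D, hD⟩ := hm.2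
  refine ⟨hh.1.mul hm.1, j + k, C * D, fun r hr => ?_⟩
  rw [abs_mul]
  calc |h r| * |m r| ≤ (C * (1 + r) ^ j) * (D * (1 + r) ^ k) :=
        mul_le_mul (hC r hr) (hD r hr) (abs_nonneg _) ((abs_nonneg _).trans (hC r hr))
    _ = _ := by ring

lemma Slow.const (c : ℝ) : Slow (fun _ => c) :=
  ⟨continuousOn_const, 0, |c|, fun r _ => by simp⟩

lemma Slow.pow (k : ℕ) : Slow (fun r => r ^ k) := by
  refine ⟨by fun_prop, k, 1, fun r hr => ?_⟩
  rw [abs_of_nonneg (pow_nonneg hr k), one_mul]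
  exact pow_le_pow_left₀ hr (by linarith) k

lemma Slow.rho (p : ℝ) (hp : p ≤ 0) : Slow (fun r => (1 + r ^ 2) ^ p) := by
  refine ⟨?_, 0, 1, fun r hr => ?_⟩
  · apply Continuous.continuousOn
    exact Continuous.rpow_const (by fun_prop) (fun x => Or.inl (by positivity))
  · rw [abs_of_nonneg (by positivity)]
    simpa using Real.rpow_le_one_of_one_le_of_nonpos (by nlinarith) hp

lemma Slow.inv (k : ℕ) : Slow (fun r => 1 / (1 + r ^ 2) ^ k) := by
  refine ⟨?_, 0, 1, fun r hr => ?_⟩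
  · apply Continuous.continuousOn
    exact Continuous.div (by fun_prop) (by fun_prop) (fun x => by positivity)
  · rw [abs_of_nonneg (by positivity)]
    have : 1 ≤ (1 + r ^ 2) ^ k := one_le_pow₀ (by nlinarith)
    simpa using inv_le_one_of_one_le₀ this

lemma Rap.integrableOn {h : ℝ → ℝ} (hh : Rap h) : IntegrableOn h (Ioi 0) := by
  obtain ⟨C, hC⟩ := hh.2 2
  have h1 : IntegrableOn (fun r : ℝ => C * (1 + r ^ 2)⁻¹) (Ioi 0) :=
    (integrable_inv_one_add_sq.const_mul C).integrableOn
  refine Integrable.mono' h1 ((hh.1.mono Ioi_subset_Ici_self).aestronglyMeasurable measurableSet_Ioi) ?_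
  filter_upwards [ae_restrict_mem measurableSet_Ioi] with r hr
  have hr : 0 < r := hr
  have := hC r hr.le
  rw [Real.norm_eq_abs, ← div_eq_mul_inv, le_div_iff₀ (by positivity)]
  nlinarith [abs_nonneg (h r), mul_nonneg hr.le (abs_nonneg (h r))]

lemma Rap.tendsto {h : ℝ → ℝ} (hh : Rap h) : Tendsto h atTop (𝓝 0) := by
  obtain ⟨C, hC⟩ := hh.2 1
  have h1 : Tendsto (fun r : ℝ => C / r) atTop (𝓝 0) := tendsto_const_nhds.div_atTop tendsto_id
  refine squeeze_zero_norm' ?_ h1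
  filter_upwards [eventually_gt_atTop 0] with r hr
  have := hC r hr.le
  rw [Real.norm_eq_abs, le_div_iff₀ hr]
  nlinarith [abs_nonneg (h r)]

lemma rap_schwartz (f : SchwartzMap ℝ ℝ) : Rap f := by
  refine ⟨f.continuous.continuousOn, fun k => ?_⟩
  have := f.one_add_le_sup_seminorm_apply (𝕜 := ℝ) (m := (k, 0)) (k := k) (n := 0) le_rfl le_rfl
  refine ⟨2 ^ k * ((Finset.Iic (k, 0)).sup fun m => SchwartzMap.seminorm ℝ m.1 m.2) f,
    fun r hr => ?_⟩
  have h := this r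
  rw [norm_iteratedFDeriv_zero, Real.norm_eq_abs, Real.norm_eq_abs, abs_of_nonneg hr] at h
  exact h

/-- weighted Cauchy-Schwarz -/
lemma cs_weight {s : Set ℝ} (hs : MeasurableSet s) (w p q : ℝ → ℝ) (hw : ∀ r ∈ s, 0 ≤ w r)
    (h1 : IntegrableOn (fun r => w r * p r ^ 2) s)
    (h2 : IntegrableOn (fun r => w r * q r ^ 2) s)
    (h3 : IntegrableOn (fun r => w r * q r * p r) s) :
    (∫ r in s, w r * q r * p r) ^ 2 ≤ (∫ r in s, w r * p r ^ 2) * (∫ r in s, w r * q r ^ 2) := by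
  have key : ∀ t : ℝ, 0 ≤ (∫ r in s, w r * p r ^ 2) * (t * t) +
      (2 * ∫ r in s, w r * q r * p r) * t + (∫ r in s, w r * q r ^ 2) := by
    intro t
    have e : (∫ r in s, w r * p r ^ 2) * (t * t) +
      (2 * ∫ r in s, w r * q r * p r) * t + (∫ r in s, w r * q r ^ 2)
      = ∫ r in s, ((t * t) * (w r * p r ^ 2) + (2 * t) * (w r * q r * p r)) + w r * q r ^ 2 := by
      have h4 : IntegrableOn (fun r => (t * t) * (w r * p r ^ 2) + (2 * t) * (w r * q r * p r)) s :=
        (h1.const_mul _).add (h3.const_mul _)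
      rw [integral_add h4 h2, integral_add (h1.const_mul _) (h3.const_mul _), integral_const_mul, integral_const_mul]
      ring
    rw [e]
    refine setIntegral_nonneg hs fun r hr => ?_
    have := mul_nonneg (hw r hr) (sq_nonneg (t * p r + q r))
    nlinarith
  have := discrim_le_zero key
  unfold discrim at this
  nlinarith

/-- the basic model integrability -/
lemma int_model (s t : ℝ) (hs : 0 ≤ s) (h : s / 2 + t ≤ -(3 / 4)) :
    IntegrableOn (fun r : ℝ => r ^ s * (1 + r ^ 2) ^ t) (Ioi 0) := by
  have h1 : Integrable (fun r : ℝ => (1 + ‖r‖ ^ 2) ^ (-(3 / 2 : ℝ) / 2)) :=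
    integrable_rpow_neg_one_add_norm_sq (by simp; norm_num)
  refine Integrable.mono' h1.integrableOn (ContinuousOn.aestronglyMeasurable ?_ measurableSet_Ioi) ?_
  · intro r hr
    have hr : 0 < r := hr
    apply ContinuousAt.continuousWithinAt
    apply ContinuousAt.mul
    · exact Real.continuousAt_rpow_const _ _ (Or.inl hr.ne')
    · exact ContinuousAt.rpow_const (by fun_prop) (Or.inl (by positivity))
  filter_upwards [ae_restrict_mem measurableSet_Ioi] with r hr
  have hr : 0 < r := hr
  rw [Real.norm_of_nonneg (by positivity), Real.norm_of_nonneg hr.le]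
  have h2 : r ^ s ≤ (1 + r ^ 2) ^ (s / 2) := by
    calc r ^ s = (r ^ 2) ^ (s / 2) := by
          rw [← Real.rpow_natCast, ← Real.rpow_mul hr.le]; congr 1; push_cast; ring
      _ ≤ _ := by
          apply Real.rpow_le_rpow (by positivity) (by linarith) (by linarith)
  calc r ^ s * (1 + r ^ 2) ^ t ≤ (1 + r ^ 2) ^ (s / 2) * (1 + r ^ 2) ^ t := by gcongr
    _ = (1 + r ^ 2) ^ (s / 2 + t) := by rw [← Real.rpow_add (by positivity)]
    _ ≤ _ := by
      apply Real.rpow_le_rpow_of_exponent_le (by nlinarith)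
      linarith

noncomputable def psi (n : ℕ) (f f1 : ℝ → ℝ) (r : ℝ) : ℝ := f1 r + ((n : ℝ) + 9) * r * f r / (1 + r ^ 2)

/-- r times the second order expression -/
noncomputable def Er (n : ℕ) (f f1 f2 : ℝ → ℝ) (r : ℝ) : ℝ :=
  r * f2 r + (((n : ℝ) + 12) - 4 * r ^ 2 / (1 + r ^ 2)) * f1 r +
    ((n : ℝ) + 9) * r * ((n : ℝ) + 13 - 2 * r ^ 2) / (1 + r ^ 2) ^ 2 * f r

lemma rap_psi {n : ℕ} {f f1 : ℝ → ℝ} (h0 : Rap f) (h1 : Rap f1) : Rap (psi n f f1) := by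
  have := h1.add (h0.mul_slow (((Slow.const ((n : ℝ) + 9)).mul (Slow.pow 1)).mul (Slow.inv 1)))
  convert this using 1
  funext r
  simp only [psi, pow_one]
  ring

lemma rap_Er {n : ℕ} {f f1 f2 : ℝ → ℝ} (h0 : Rap f) (h1 : Rap f1) (h2 : Rap f2) :
    Rap (Er n f f1 f2) := by
  have := ((h2.mul_slow (Slow.pow 1)).add (h1.mul_slow ((Slow.const ((n : ℝ) + 12)).add
    (((Slow.const (-4)).mul (Slow.pow 2)).mul (Slow.inv 1))))).add
    (h0.mul_slow ((((Slow.const ((n : ℝ) + 9)).mul (Slow.pow 1)).mul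
    ((Slow.const ((n : ℝ) + 13)).add ((Slow.const (-2)).mul (Slow.pow 2)))).mul (Slow.inv 2)))
  convert this using 1
  funext r
  simp only [Er, pow_one]
  ring

lemma rap_L {n : ℕ} {f1 f2 : ℝ → ℝ} (h1 : Rap f1) (h2 : Rap f2) :
    Rap (fun r => r * f2 r + ((n : ℝ) + 12) * f1 r) := by
  have := (h2.mul_slow (Slow.pow 1)).add (h1.mul_slow (Slow.const ((n : ℝ) + 12)))
  convert this using 1
  funext r
  simp only [pow_one]

lemma Rap.sq {m h : ℝ → ℝ} (hh : Rap h) (hm : Slow m) : Rap (fun r => m r * h r ^ 2) := by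
  have := (hh.mul_slow hh.slow).mul_slow hm
  convert this using 1
  funext r
  ring

noncomputable def Tfun (n : ℕ) (f f1 : ℝ → ℝ) (r : ℝ) : ℝ :=
  r ^ (n + 12) * ((-4 * ((n : ℝ) + 9) * r / (1 + r ^ 2) ^ 2
      - ((n : ℝ) + 9) * (2 * ((n : ℝ) + 13) ^ 2 - 4 * ((n : ℝ) + 13) - 8) * r / (1 + r ^ 2) ^ 3)
        * f r ^ 2
    - 2 * ((n : ℝ) + 9) * ((n : ℝ) + 13 - 2 * r ^ 2) / (1 + r ^ 2) ^ 2 * (f r * f1 r)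
    + 4 * r / (1 + r ^ 2) * f1 r ^ 2)

lemma rap_T {n : ℕ} {f f1 : ℝ → ℝ} (h0 : Rap f) (h1 : Rap f1) : Rap (Tfun n f f1) := by
  have a1 := h0.sq ((Slow.pow (n + 12)).mul
    ((((Slow.const (-4 * ((n : ℝ) + 9))).mul (Slow.pow 1)).mul (Slow.inv 2)).add
    (((Slow.const (- (((n : ℝ) + 9) * (2 * ((n : ℝ) + 13) ^ 2 - 4 * ((n : ℝ) + 13) - 8)))).mul
      (Slow.pow 1)).mul (Slow.inv 3))))
  have a2 := (h1.mul_slow h0.slow).mul_slow ((Slow.pow (n + 12)).mul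
    (((Slow.const (-2 * ((n : ℝ) + 9))).mul ((Slow.const ((n : ℝ) + 13)).add
      ((Slow.const (-2)).mul (Slow.pow 2)))).mul (Slow.inv 2)))
  have a3 := h1.sq ((Slow.pow (n + 12)).mul
    (((Slow.const 4).mul (Slow.pow 1)).mul (Slow.inv 1)))
  convert (a1.add a2).add a3 using 1
  funext r
  simp only [Tfun, pow_one]
  ring

noncomputable def T1fun (n : ℕ) (f f1 f2 : ℝ → ℝ) (r : ℝ) : ℝ :=
  r ^ (n + 10) * (r * f2 r + ((n : ℝ) + 12) * f1 r) ^ 2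
    - r ^ (n + 12) * (((n : ℝ) + 13) * ((n : ℝ) + 9) * (((n : ℝ) + 13) ^ 2 - 4)
        / (1 + r ^ 2) ^ 4) * f r ^ 2
    - r ^ (n + 10) * Er n f f1 f2 r ^ 2
    - r ^ (n + 12) * ((2 * ((n : ℝ) + 13) ^ 2 - 4 * ((n : ℝ) + 13) - 8) / (1 + r ^ 2) ^ 2)
        * psi n f f1 r ^ 2

lemma hasDerivAt_T {n : ℕ} {f f1 f2 : ℝ → ℝ} (hf : ∀ r, HasDerivAt f (f1 r) r)
    (hf1 : ∀ r, HasDerivAt f1 (f2 r) r) (r : ℝ) :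
    HasDerivAt (Tfun n f f1) (T1fun n f f1 f2 r) r := by
  have hρ : HasDerivAt (fun r : ℝ => 1 + r ^ 2) (2 * r) r := by
    simpa using (hasDerivAt_pow 2 r).const_add 1
  have hid := hasDerivAt_id' r
  have hp := hasDerivAt_pow (n + 12) r
  have hne : (1 + r ^ 2) ≠ 0 := by positivity
  have k1 := (((hid.const_mul (-4 * ((n : ℝ) + 9))).div (hρ.pow 2) (pow_ne_zero _ hne)).sub
    ((hid.const_mul (((n : ℝ) + 9) * (2 * ((n : ℝ) + 13) ^ 2 - 4 * ((n : ℝ) + 13) - 8))).div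
      (hρ.pow 3) (pow_ne_zero _ hne))).mul ((hf r).pow 2)
  have k2 := (((((hasDerivAt_pow 2 r).const_mul 2).const_sub ((n : ℝ) + 13)).const_mul
    (2 * ((n : ℝ) + 9))).div (hρ.pow 2) (pow_ne_zero _ hne)).mul ((hf r).mul (hf1 r))
  have k3 := ((hid.const_mul 4).div hρ hne).mul ((hf1 r).pow 2)
  have k := hp.mul ((k1.sub k2).add k3)
  have k' : HasDerivAt (Tfun n f f1) _ r := k
  refine k'.congr_deriv ?_
  simp only [T1fun, Er, psi, Pi.pow_apply, Pi.mul_apply, Pi.div_apply, Pi.sub_apply, Pi.add_apply]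
  have e1 : r ^ (n + 12) = r ^ (n + 10) * r ^ 2 := by ring
  have e2 : r ^ (n + 12 - 1) = r ^ (n + 10) * r := by
    rw [show n + 12 - 1 = n + 11 by omega]; ring
  rw [e1, e2]
  generalize r ^ (n + 10) = R
  push_cast
  generalize (n : ℝ) = x
  field_simp
  ring

noncomputable def Yint (n : ℕ) (f f1 f2 : ℝ → ℝ) : ℝ :=
  ∫ r in Ioi (0 : ℝ), r ^ (n + 10) * Er n f f1 f2 r ^ 2

noncomputable def Aint (n : ℕ) (f1 f2 : ℝ → ℝ) : ℝ :=
  ∫ r in Ioi (0 : ℝ), r ^ (n + 10) * (r * f2 r + ((n : ℝ) + 12) * f1 r) ^ 2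

noncomputable def Bint (n : ℕ) (f : ℝ → ℝ) : ℝ :=
  ∫ r in Ioi (0 : ℝ), r ^ (n + 12) * (((n : ℝ) + 13) * ((n : ℝ) + 9) * (((n : ℝ) + 13) ^ 2 - 4)
        / (1 + r ^ 2) ^ 4) * f r ^ 2

lemma Y_nonneg (n : ℕ) (f f1 f2 : ℝ → ℝ) : 0 ≤ Yint n f f1 f2 := by
  refine setIntegral_nonneg measurableSet_Ioi fun r hr => ?_
  have hr : 0 < r := hr
  positivity

lemma rap_Y {n : ℕ} {f f1 f2 : ℝ → ℝ} (h0 : Rap f) (h1 : Rap f1) (h2 : Rap f2) :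
    Rap (fun r => r ^ (n + 10) * Er n f f1 f2 r ^ 2) :=
  (rap_Er h0 h1 h2).sq (Slow.pow _)

lemma rap_B {n : ℕ} {f : ℝ → ℝ} (h0 : Rap f) :
    Rap (fun r => r ^ (n + 12) * (((n : ℝ) + 13) * ((n : ℝ) + 9) * (((n : ℝ) + 13) ^ 2 - 4)
        / (1 + r ^ 2) ^ 4) * f r ^ 2) := by
  have := h0.sq ((Slow.pow (n + 12)).mul ((Slow.const
    (((n : ℝ) + 13) * ((n : ℝ) + 9) * (((n : ℝ) + 13) ^ 2 - 4))).mul (Slow.inv 4)))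
  convert this using 1
  funext r
  ring

lemma integral_sub4 {s : Set ℝ} {a b c d : ℝ → ℝ} (ha : IntegrableOn a s) (hb : IntegrableOn b s)
    (hc : IntegrableOn c s) (hd : IntegrableOn d s) :
    ∫ r in s, a r - b r - c r - d r
      = (∫ r in s, a r) - (∫ r in s, b r) - (∫ r in s, c r) - (∫ r in s, d r) := by
  have e1 := integral_sub ha hb
  have e2 := integral_sub (ha.sub hb) hc
  have e3 := integral_sub ((ha.sub hb).sub hc) hd
  simp only [Pi.sub_apply] at e1 e2 e3
  linarith

lemma Y_le {n : ℕ} {f f1 f2 : ℝ → ℝ} (hf : ∀ r, HasDerivAt f (f1 r) r)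
    (hf1 : ∀ r, HasDerivAt f1 (f2 r) r) (h0 : Rap f) (h1 : Rap f1) (h2 : Rap f2) :
    Yint n f f1 f2 ≤ Aint n f1 f2 - Bint n f := by
  have iA : IntegrableOn (fun r : ℝ => r ^ (n + 10) * (r * f2 r + ((n : ℝ) + 12) * f1 r) ^ 2)
    (Ioi 0) := ((rap_L h1 h2).sq (Slow.pow _)).integrableOn
  have iB := (rap_B (n := n) h0).integrableOn
  have iY := (rap_Y (n := n) h0 h1 h2).integrableOn
  have rP : Rap (fun r => r ^ (n + 12) * ((2 * ((n : ℝ) + 13) ^ 2 - 4 * ((n : ℝ) + 13) - 8)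
      / (1 + r ^ 2) ^ 2) * psi n f f1 r ^ 2) := by
    have := (rap_psi (n := n) h0 h1).sq ((Slow.pow (n + 12)).mul ((Slow.const
      (2 * ((n : ℝ) + 13) ^ 2 - 4 * ((n : ℝ) + 13) - 8)).mul (Slow.inv 2)))
    convert this using 1
    funext r
    ring
  have iP := rP.integrableOn
  have hP : 0 ≤ ∫ r in Ioi (0 : ℝ), r ^ (n + 12) *
      ((2 * ((n : ℝ) + 13) ^ 2 - 4 * ((n : ℝ) + 13) - 8)
      / (1 + r ^ 2) ^ 2) * psi n f f1 r ^ 2 := by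
    refine setIntegral_nonneg measurableSet_Ioi fun r hr => ?_
    have hr : 0 < r := hr
    have hn : (0 : ℝ) ≤ n := Nat.cast_nonneg n
    have : 0 ≤ (2 * ((n : ℝ) + 13) ^ 2 - 4 * ((n : ℝ) + 13) - 8) := by nlinarith
    positivity
  have iT : IntegrableOn (T1fun n f f1 f2) (Ioi 0) := ((iA.sub iB).sub iY).sub iP
  have hT : ∫ r in Ioi (0 : ℝ), T1fun n f f1 f2 r = 0 := by
    rw [integral_Ioi_of_hasDerivAt_of_tendsto' (fun r _ => hasDerivAt_T hf hf1 r) iT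
      (rap_T h0 h1).tendsto]
    simp [Tfun]
  unfold T1fun at hT
  rw [integral_sub4 iA iB iY iP] at hT
  simp only [Yint, Aint, Bint]
  linarith

noncomputable def om (n : ℕ) (f f1 : ℝ → ℝ) (r : ℝ) : ℝ :=
  r ^ (n + 12) * (1 + r ^ 2) ^ (-(((n : ℝ) + 13) / 2)) * psi n f f1 r

lemma hasDerivAt_rho (p r : ℝ) :
    HasDerivAt (fun r : ℝ => (1 + r ^ 2) ^ p) (p * (2 * r) * (1 + r ^ 2) ^ p / (1 + r ^ 2)) r := by
  have hρ : HasDerivAt (fun r : ℝ => 1 + r ^ 2) (2 * r) r := by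
    simpa using (hasDerivAt_pow 2 r).const_add 1
  have hpos : (0 : ℝ) < 1 + r ^ 2 := by positivity
  have := hρ.rpow_const (p := p) (Or.inl hpos.ne')
  refine this.congr_deriv ?_
  rw [Real.rpow_sub_one hpos.ne']
  ring

lemma hasDerivAt_om {n : ℕ} {f f1 f2 : ℝ → ℝ} (hf : ∀ r, HasDerivAt f (f1 r) r)
    (hf1 : ∀ r, HasDerivAt f1 (f2 r) r) (r : ℝ) :
    HasDerivAt (om n f f1)
      (r ^ (n + 10) * (r * (1 + r ^ 2) ^ (-(((n : ℝ) + 13) / 2))) * Er n f f1 f2 r) r := by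
  have hρ : HasDerivAt (fun r : ℝ => 1 + r ^ 2) (2 * r) r := by
    simpa using (hasDerivAt_pow 2 r).const_add 1
  have hne : (1 + r ^ 2) ≠ 0 := by positivity
  have k1 := (hf1 r).add ((((hasDerivAt_id' r).const_mul ((n : ℝ) + 9)).mul (hf r)).div hρ hne)
  have k := ((hasDerivAt_pow (n + 12) r).mul
    (hasDerivAt_rho (-(((n : ℝ) + 13) / 2)) r)).mul k1
  have k' : HasDerivAt (om n f f1) _ r := k
  refine k'.congr_deriv ?_
  simp only [Er, Pi.mul_apply, Pi.div_apply, Pi.add_apply]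
  have e1 : r ^ (n + 12) = r ^ (n + 10) * r ^ 2 := by ring
  have e2 : r ^ (n + 12 - 1) = r ^ (n + 10) * r := by
    rw [show n + 12 - 1 = n + 11 by omega]; ring
  rw [e1, e2]
  generalize r ^ (n + 10) = R
  generalize (1 + r ^ 2) ^ (-(((n : ℝ) + 13) / 2)) = Q
  push_cast
  generalize (n : ℝ) = x
  field_simp
  ring

lemma q_sq (n : ℕ) {r : ℝ} :
    r ^ (n + 10) * (r * (1 + r ^ 2) ^ (-(((n : ℝ) + 13) / 2))) ^ 2
      = r ^ (n + 12) / (1 + r ^ 2) ^ (n + 13) := by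
  have hpos : (0 : ℝ) < 1 + r ^ 2 := by positivity
  have : ((1 + r ^ 2) ^ (-(((n : ℝ) + 13) / 2))) ^ 2 = ((1 + r ^ 2) ^ (n + 13))⁻¹ := by
    generalize 1 + r ^ 2 = x at *
    rw [← Real.rpow_natCast, ← Real.rpow_mul hpos.le, ← Real.rpow_natCast, ← Real.rpow_neg hpos.le]
    congr 1
    push_cast
    ring
  rw [mul_pow, this]
  ring

lemma om_bounds {n : ℕ} {f f1 f2 : ℝ → ℝ} (hf : ∀ r, HasDerivAt f (f1 r) r)
    (hf1 : ∀ r, HasDerivAt f1 (f2 r) r) (h0 : Rap f) (h1 : Rap f1) (h2 : Rap f2)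
    {r : ℝ} (hr : 0 < r) :
    om n f f1 r ^ 2 ≤ Yint n f f1 f2 * r ^ (n + 13) ∧
    om n f f1 r ^ 2 ≤ Yint n f f1 f2 * (r ^ (n + 13))⁻¹ := by
  have iY := (rap_Y (n := n) h0 h1 h2).integrableOn
  have hn : (0 : ℝ) ≤ n := Nat.cast_nonneg n
  have hpneg : -(((n : ℝ) + 13) / 2) ≤ 0 := by linarith
  have rO' : Rap (fun t => t ^ (n + 10) * (t * (1 + t ^ 2) ^ (-(((n : ℝ) + 13) / 2)))
      * Er n f f1 f2 t) := by
    have := (rap_Er (n := n) h0 h1 h2).mul_slow ((Slow.pow (n + 10)).mul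
      ((Slow.pow 1).mul (Slow.rho _ hpneg)))
    convert this using 1
    funext t
    simp only [pow_one]
  have rO : Rap (om n f f1) :=
    (rap_psi (n := n) h0 h1).mul_slow ((Slow.pow (n + 12)).mul (Slow.rho _ hpneg))
  have iO' := rO'.integrableOn
  have q1 : ∀ t : ℝ, 0 < t → t ^ (n + 12) / (1 + t ^ 2) ^ (n + 13) ≤ t ^ (n + 12) := by
    intro t ht
    apply div_le_self (by positivity)
    exact one_le_pow₀ (by nlinarith)
  have q2 : ∀ t : ℝ, 0 < t → t ^ (n + 12) / (1 + t ^ 2) ^ (n + 13) ≤ t ^ (-((n : ℝ) + 14)) := by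
    intro t ht
    rw [Real.rpow_neg ht.le, show (n : ℝ) + 14 = ((n + 14 : ℕ) : ℝ) by push_cast; ring,
      Real.rpow_natCast, div_le_iff₀ (by positivity), inv_mul_eq_div, le_div_iff₀ (by positivity)]
    calc t ^ (n + 12) * t ^ (n + 14) = (t ^ 2) ^ (n + 13) := by ring
      _ ≤ _ := by gcongr; linarith
  have iQ : IntegrableOn (fun t : ℝ => t ^ (n + 10) *
      (t * (1 + t ^ 2) ^ (-(((n : ℝ) + 13) / 2))) ^ 2) (Ioi 0) := by
    simp only [q_sq]
    have := int_model ((n : ℝ) + 12) (-((n : ℝ) + 13)) (by linarith) (by linarith)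
    refine this.congr_fun (fun t ht => ?_) measurableSet_Ioi
    have ht : 0 < t := ht
    simp only
    rw [Real.rpow_neg (by positivity), show (n : ℝ) + 12 = ((n + 12 : ℕ) : ℝ) by push_cast; ring,
      show (n : ℝ) + 13 = ((n + 13 : ℕ) : ℝ) by push_cast; ring,
      Real.rpow_natCast, Real.rpow_natCast]
    rfl
  have main : ∀ s ⊆ Ioi (0 : ℝ), MeasurableSet s → ∀ V : ℝ,
      (∫ t in s, t ^ (n + 12) / (1 + t ^ 2) ^ (n + 13)) ≤ V →
      (∫ t in s, t ^ (n + 10) * (t * (1 + t ^ 2) ^ (-(((n : ℝ) + 13) / 2)))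
      * Er n f f1 f2 t) ^ 2 ≤ Yint n f f1 f2 * V := by
    intro s hs hms V hV
    have := cs_weight hms (fun t => t ^ (n + 10)) (Er n f f1 f2)
      (fun t => t * (1 + t ^ 2) ^ (-(((n : ℝ) + 13) / 2)))
      (fun t ht => by have : 0 < t := hs ht
                      positivity)
      (iY.mono_set hs) (iQ.mono_set hs) (iO'.mono_set hs)
    refine this.trans ?_
    simp only [q_sq]
    have hY : ∫ t in s, t ^ (n + 10) * Er n f f1 f2 t ^ 2 ≤ Yint n f f1 f2 := by
      refine setIntegral_mono_set iY ?_ hs.eventuallyLE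
      filter_upwards [ae_restrict_mem measurableSet_Ioi] with t ht
      have ht : 0 < t := ht
      simp only [Pi.zero_apply]
      positivity
    refine mul_le_mul hY hV ?_ (Y_nonneg n f f1 f2)
    refine setIntegral_nonneg hms fun t ht => ?_
    have : 0 < t := hs ht
    positivity
  simp only [q_sq] at iQ
  constructor
  · have e : om n f f1 r = ∫ t in Ioc 0 r, t ^ (n + 10) *
        (t * (1 + t ^ 2) ^ (-(((n : ℝ) + 13) / 2))) * Er n f f1 f2 t := by
      rw [← intervalIntegral.integral_of_le hr.le,
        intervalIntegral.integral_eq_sub_of_hasDerivAt (fun t _ => hasDerivAt_om hf hf1 t)]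
      · simp [om]
      · rw [intervalIntegrable_iff_integrableOn_Ioc_of_le hr.le]
        exact iO'.mono_set Ioc_subset_Ioi_self
    rw [e]
    refine main _ Ioc_subset_Ioi_self measurableSet_Ioc _ ?_
    calc ∫ t in Ioc 0 r, t ^ (n + 12) / (1 + t ^ 2) ^ (n + 13) ≤ ∫ t in Ioc 0 r, t ^ (n + 12) := by
          refine setIntegral_mono_on (iQ.mono_set Ioc_subset_Ioi_self) ?_ measurableSet_Ioc
            (fun t ht => q1 t ht.1)
          rw [← intervalIntegrable_iff_integrableOn_Ioc_of_le hr.le]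
          exact (continuous_pow _).intervalIntegrable _ _
      _ = r ^ (n + 13) / ((n : ℝ) + 13) := by
          rw [← intervalIntegral.integral_of_le hr.le, integral_pow]
          push_cast
          simp
          ring
      _ ≤ r ^ (n + 13) := div_le_self (by positivity) (by linarith)
  · have e : om n f f1 r = - ∫ t in Ioi r, t ^ (n + 10) *
        (t * (1 + t ^ 2) ^ (-(((n : ℝ) + 13) / 2))) * Er n f f1 f2 t := by
      rw [integral_Ioi_of_hasDerivAt_of_tendsto' (fun t _ => hasDerivAt_om hf hf1 t)
        (iO'.mono_set (Ioi_subset_Ioi hr.le)) rO.tendsto]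
      ring
    rw [e, neg_sq]
    refine main _ (Ioi_subset_Ioi hr.le) measurableSet_Ioi _ ?_
    calc ∫ t in Ioi r, t ^ (n + 12) / (1 + t ^ 2) ^ (n + 13)
          ≤ ∫ t in Ioi r, t ^ (-((n : ℝ) + 14)) := by
          refine setIntegral_mono_on (iQ.mono_set (Ioi_subset_Ioi hr.le))
            (integrableOn_Ioi_rpow_of_lt (by linarith) hr) measurableSet_Ioi
            (fun t ht => q2 t (hr.trans ht))
      _ = (r ^ (n + 13))⁻¹ / ((n : ℝ) + 13) := by
          rw [integral_Ioi_rpow_of_lt (by linarith) hr,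
            show -((n : ℝ) + 14) + 1 = -((n + 13 : ℕ) : ℝ) by push_cast; ring,
            Real.rpow_neg hr.le, Real.rpow_natCast]
          push_cast
          rw [neg_div_neg_eq]
      _ ≤ _ := div_le_self (by positivity) (by linarith)

noncomputable def uf (n : ℕ) (f : ℝ → ℝ) (r : ℝ) : ℝ := (1 + r ^ 2) ^ (((n : ℝ) + 9) / 2) * f r

lemma hasDerivAt_uf {n : ℕ} {f f1 : ℝ → ℝ} (hf : ∀ r, HasDerivAt f (f1 r) r) (r : ℝ) :
    HasDerivAt (uf n f) ((1 + r ^ 2) ^ (((n : ℝ) + 9) / 2) * psi n f f1 r) r := by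
  have k : HasDerivAt (uf n f) _ r := (hasDerivAt_rho (((n : ℝ) + 9) / 2) r).mul (hf r)
  refine k.congr_deriv ?_
  have hne : (1 + r ^ 2) ≠ 0 := by positivity
  simp only [psi]
  generalize (1 + r ^ 2) ^ (((n : ℝ) + 9) / 2) = Q
  field_simp
  ring

lemma uf_om {n : ℕ} {f f1 : ℝ → ℝ} (r : ℝ) :
    ((1 + r ^ 2) ^ (((n : ℝ) + 9) / 2) * psi n f f1 r) * r ^ (n + 12)
      = (1 + r ^ 2) ^ (n + 11) * om n f f1 r := by
  have hpos : (0 : ℝ) < 1 + r ^ 2 := by positivity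
  unfold om
  generalize 1 + r ^ 2 = x at *
  have : x ^ (((n : ℝ) + 9) / 2) = x ^ (n + 11) * x ^ (-(((n : ℝ) + 13) / 2)) := by
    rw [← Real.rpow_natCast, ← Real.rpow_add hpos]
    congr 1
    push_cast
    ring
  rw [this]
  ring

lemma sqrt_pow_eq (n : ℕ) {r : ℝ} (hr : 0 < r) :
    Real.sqrt (r ^ (n + 13)) = r ^ (((n : ℝ) + 13) / 2) := by
  rw [Real.sqrt_eq_rpow, ← Real.rpow_natCast, ← Real.rpow_mul hr.le]
  congr 1
  push_cast
  ring

lemma du_bound {n : ℕ} {f f1 f2 : ℝ → ℝ} (hf : ∀ r, HasDerivAt f (f1 r) r)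
    (hf1 : ∀ r, HasDerivAt f1 (f2 r) r) (h0 : Rap f) (h1 : Rap f1) (h2 : Rap f2)
    {r : ℝ} (hr : 0 < r) :
    |(1 + r ^ 2) ^ (((n : ℝ) + 9) / 2) * psi n f f1 r| ≤ 2 ^ (n + 11) * √(Yint n f f1 f2) *
      (r ^ (((n : ℝ) + 7) / 2) + r ^ (-(((n : ℝ) + 11) / 2))) := by
  obtain ⟨b1, b2⟩ := om_bounds (n := n) hf hf1 h0 h1 h2 hr
  have hY := Y_nonneg n f f1 f2
  have c1 : |om n f f1 r| ≤ √(Yint n f f1 f2) * r ^ (((n : ℝ) + 13) / 2) := by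
    rw [← sqrt_pow_eq n hr, ← Real.sqrt_mul hY]
    exact Real.abs_le_sqrt b1
  have c2 : |om n f f1 r| ≤ √(Yint n f f1 f2) * (r ^ (((n : ℝ) + 13) / 2))⁻¹ := by
    rw [← sqrt_pow_eq n hr, ← Real.sqrt_inv, ← Real.sqrt_mul hY]
    exact Real.abs_le_sqrt b2
  have e := congrArg abs (uf_om (n := n) (f := f) (f1 := f1) r)
  rw [abs_mul, abs_mul ((1 + r ^ 2) ^ (n + 11)), abs_of_pos (show 0 < r ^ (n + 12) by positivity),
    abs_of_pos (show 0 < (1 + r ^ 2) ^ (n + 11) by positivity)] at e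
  have hp : 0 < r ^ (n + 12) := by positivity
  refine le_of_mul_le_mul_right ?_ hp
  rw [e]
  have hS := Real.sqrt_nonneg (Yint n f f1 f2)
  rcases le_total r 1 with h | h
  · calc (1 + r ^ 2) ^ (n + 11) * |om n f f1 r|
        ≤ 2 ^ (n + 11) * (√(Yint n f f1 f2) * r ^ (((n : ℝ) + 13) / 2)) := by
          gcongr
          nlinarith
      _ = 2 ^ (n + 11) * √(Yint n f f1 f2) * (0 + r ^ (-(((n : ℝ) + 11) / 2))) * r ^ (n + 12) := by
          have : r ^ (((n : ℝ) + 13) / 2) = r ^ (-(((n : ℝ) + 11) / 2)) * r ^ (n + 12) := by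
            rw [← Real.rpow_natCast, ← Real.rpow_add hr]
            congr 1
            push_cast
            ring
          rw [this]
          ring
      _ ≤ _ := by
          gcongr
          positivity
  · calc (1 + r ^ 2) ^ (n + 11) * |om n f f1 r|
        ≤ (2 * r ^ 2) ^ (n + 11) * (√(Yint n f f1 f2) * (r ^ (((n : ℝ) + 13) / 2))⁻¹) := by
          gcongr
          nlinarith
      _ = 2 ^ (n + 11) * √(Yint n f f1 f2) * (r ^ (((n : ℝ) + 7) / 2) + 0) * r ^ (n + 12) := by
          have : (r ^ 2) ^ (n + 11) * (r ^ (((n : ℝ) + 13) / 2))⁻¹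
              = r ^ (((n : ℝ) + 7) / 2) * r ^ (n + 12) := by
            rw [← Real.rpow_neg hr.le, ← pow_mul, ← Real.rpow_natCast, ← Real.rpow_natCast,
              ← Real.rpow_add hr, ← Real.rpow_add hr]
            congr 1
            push_cast
            ring
          rw [mul_pow]
          linear_combination 2 ^ (n + 11) * √(Yint n f f1 f2) * this
      _ ≤ _ := by
          gcongr
          positivity

lemma u_bound {n : ℕ} {f f1 f2 : ℝ → ℝ} (hf : ∀ r, HasDerivAt f (f1 r) r)
    (hf1 : ∀ r, HasDerivAt f1 (f2 r) r) (h0 : Rap f) (h1 : Rap f1) (h2 : Rap f2)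
    {r : ℝ} (hr : 0 < r) :
    |uf n f r - uf n f 1| ≤ 2 ^ (n + 11) * √(Yint n f f1 f2) *
      (r ^ (((n : ℝ) + 9) / 2) + r ^ (-(((n : ℝ) + 9) / 2))) := by
  set M := 2 ^ (n + 11) * √(Yint n f f1 f2) with hM
  have hM0 : 0 ≤ M := by positivity
  have hn : (0 : ℝ) ≤ n := Nat.cast_nonneg n
  set p := ((n : ℝ) + 9) / 2 with hp
  have hp1 : 1 ≤ p := by rw [hp]; linarith
  have hβ : ∀ t : ℝ, 0 < t → HasDerivAt (fun t : ℝ => M * (t ^ p - t ^ (-p)))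
      (M * (p * (t ^ (((n : ℝ) + 7) / 2) + t ^ (-(((n : ℝ) + 11) / 2))))) t := by
    intro t ht
    have a1 := Real.hasDerivAt_rpow_const (x := t) (p := p) (Or.inl ht.ne')
    have a2 := Real.hasDerivAt_rpow_const (x := t) (p := -p) (Or.inl ht.ne')
    refine ((a1.sub a2).const_mul M).congr_deriv ?_
    rw [show p - 1 = ((n : ℝ) + 7) / 2 by rw [hp]; ring,
      show -p - 1 = -(((n : ℝ) + 11) / 2) by rw [hp]; ring]
    ring
  have hdu : ∀ t : ℝ, 0 < t → |(1 + t ^ 2) ^ p * psi n f f1 t| ≤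
      M * (p * (t ^ (((n : ℝ) + 7) / 2) + t ^ (-(((n : ℝ) + 11) / 2)))) := by
    intro t ht
    refine (du_bound (n := n) hf hf1 h0 h1 h2 ht).trans ?_
    rw [← hM]
    gcongr
    have : 0 ≤ t ^ (((n : ℝ) + 7) / 2) + t ^ (-(((n : ℝ) + 11) / 2)) := by positivity
    nlinarith
  have mono : ∀ σ : ℝ, |σ| ≤ 1 →
      MonotoneOn (fun t : ℝ => M * (t ^ p - t ^ (-p)) + σ * uf n f t) (Ioi 0) := by
    intro σ hσ
    have hd : ∀ t : ℝ, 0 < t → HasDerivAt (fun t : ℝ => M * (t ^ p - t ^ (-p)) + σ * uf n f t)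
        (M * (p * (t ^ (((n : ℝ) + 7) / 2) + t ^ (-(((n : ℝ) + 11) / 2)))) +
          σ * ((1 + t ^ 2) ^ p * psi n f f1 t)) t :=
      fun t ht => (hβ t ht).add ((hasDerivAt_uf hf t).const_mul σ)
    refine monotoneOn_of_deriv_nonneg (convex_Ioi 0)
      (fun t ht => (hd t ht).continuousAt.continuousWithinAt) ?_ ?_
    · intro t ht
      rw [interior_Ioi] at ht
      exact (hd t ht).differentiableAt.differentiableWithinAt
    · intro t ht
      rw [interior_Ioi] at ht
      rw [(hd t ht).deriv]
      have h3 := hdu t ht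
      have h4 : |σ * ((1 + t ^ 2) ^ p * psi n f f1 t)| ≤ |(1 + t ^ 2) ^ p * psi n f f1 t| := by
        rw [abs_mul]
        exact mul_le_of_le_one_left (abs_nonneg _) hσ
      have := neg_abs_le (σ * ((1 + t ^ 2) ^ p * psi n f f1 t))
      linarith
  have m1 := mono 1 (by simp)
  have m2 := mono (-1) (by simp)
  have one_mem : (1 : ℝ) ∈ Ioi (0 : ℝ) := by simp
  have r1 : 0 ≤ M * r ^ p := by positivity
  have r2 : 0 ≤ M * r ^ (-p) := by positivity
  rcases le_total r 1 with h | h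
  · have a1 := m1 hr one_mem h
    have a2 := m2 hr one_mem h
    simp only [Real.one_rpow] at a1 a2
    rw [abs_le]
    constructor <;> linarith
  · have a1 := m1 one_mem hr h
    have a2 := m2 one_mem hr h
    simp only [Real.one_rpow] at a1 a2
    rw [abs_le]
    constructor <;> linarith

noncomputable def mfun (n : ℕ) (r : ℝ) : ℝ :=
  r ^ (n + 12) * (1 - r ^ 2) * (1 + r ^ 2) ^ (-((n : ℝ) + 10))

noncomputable def Lint (n : ℕ) (f : ℝ → ℝ) : ℝ :=
  ∫ r in Ioi (0 : ℝ), r ^ (n + 12) * ((1 - r ^ 2) * (1 + r ^ 2) ^ (-(((n : ℝ) + 11) / 2)) * f r)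

lemma int_model_nat (k : ℕ) (s' t : ℝ) (hs : 0 ≤ k + s') (h : (k + s') / 2 + t ≤ -(3 / 4)) :
    IntegrableOn (fun r : ℝ => r ^ k * (1 + r ^ 2) ^ t * r ^ s') (Ioi 0) := by
  refine (int_model (k + s') t hs h).congr_fun (fun r hr => ?_) measurableSet_Ioi
  have hr : 0 < r := hr
  simp only
  rw [Real.rpow_add hr, Real.rpow_natCast]
  ring

lemma int_model_nat' (k : ℕ) (t : ℝ) (h : (k : ℝ) / 2 + t ≤ -(3 / 4)) :
    IntegrableOn (fun r : ℝ => r ^ k * (1 + r ^ 2) ^ t) (Ioi 0) := by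
  have := int_model_nat k 0 t (by positivity) (by linarith)
  simpa using this

lemma int_m (n : ℕ) : IntegrableOn (mfun n) (Ioi 0) := by
  have hn : (0 : ℝ) ≤ n := Nat.cast_nonneg n
  have h1 := int_model_nat' (n + 12) (-((n : ℝ) + 10)) (by push_cast; linarith)
  have h2 := int_model_nat' (n + 14) (-((n : ℝ) + 10)) (by push_cast; linarith)
  refine (h1.sub h2).congr_fun (fun r hr => ?_) measurableSet_Ioi
  simp only [mfun, Pi.sub_apply]
  ring

lemma m_ne (n : ℕ) : (∫ r in Ioi (0 : ℝ), mfun n r) ≠ 0 := by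
  have hn : (0 : ℝ) ≤ n := Nat.cast_nonneg n
  have h1 := int_model_nat' (n + 12) (-((n : ℝ) + 10)) (by push_cast; linarith)
  have hpos : 0 < ∫ r in Ioi (0 : ℝ), r ^ (n + 12) * (1 + r ^ 2) ^ (-((n : ℝ) + 10)) := by
    rw [setIntegral_pos_iff_support_of_nonneg_ae _ h1]
    · have : Function.support (fun r : ℝ => r ^ (n + 12) * (1 + r ^ 2) ^ (-((n : ℝ) + 10))) ∩ Ioi 0
          = Ioi 0 := by
        apply inter_eq_right.mpr
        intro r hr
        have hr : 0 < r := hr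
        have : 0 < r ^ (n + 12) * (1 + r ^ 2) ^ (-((n : ℝ) + 10)) := by positivity
        exact this.ne'
      rw [this]
      simp
    · filter_upwards [ae_restrict_mem measurableSet_Ioi] with r hr
      have hr : 0 < r := hr
      simp only [Pi.zero_apply]
      positivity
  have hd : ∀ r : ℝ, HasDerivAt (fun r : ℝ => r ^ (n + 13) * (1 + r ^ 2) ^ (-((n : ℝ) + 9)))
      (((n : ℝ) + 5) * mfun n r + 8 * (r ^ (n + 12) * (1 + r ^ 2) ^ (-((n : ℝ) + 10)))) r := by
    intro r
    refine ((hasDerivAt_pow (n + 13) r).mul (hasDerivAt_rho (-((n : ℝ) + 9)) r)).congr_deriv ?_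
    have hp : (0 : ℝ) < 1 + r ^ 2 := by positivity
    have : (1 + r ^ 2) ^ (-((n : ℝ) + 9)) = (1 + r ^ 2) ^ (-((n : ℝ) + 10)) * (1 + r ^ 2) := by
      rw [← Real.rpow_add_one hp.ne']
      congr 1
      ring
    rw [this, show n + 13 - 1 = n + 12 by omega]
    simp only [mfun]
    generalize (1 + r ^ 2) ^ (-((n : ℝ) + 10)) = Q
    push_cast
    field_simp
    ring
  have ht : Tendsto (fun r : ℝ => r ^ (n + 13) * (1 + r ^ 2) ^ (-((n : ℝ) + 9))) atTop (𝓝 0) := by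
    have h1 : Tendsto (fun r : ℝ => 1 / r) atTop (𝓝 0) := tendsto_const_nhds.div_atTop tendsto_id
    refine squeeze_zero' ?_ ?_ h1
    · filter_upwards [eventually_ge_atTop 0] with r hr
      positivity
    · filter_upwards [eventually_ge_atTop 1] with r hr
      have hr0 : 0 < r := by linarith
      rw [Real.rpow_neg (by positivity), show (n : ℝ) + 9 = ((n + 9 : ℕ) : ℝ) by push_cast; ring,
        Real.rpow_natCast, ← div_eq_mul_inv, div_le_div_iff₀ (by positivity) hr0]
      calc r ^ (n + 13) * r = r ^ (n + 14) := by ring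
        _ ≤ r ^ (2 * (n + 9)) := pow_le_pow_right₀ hr (by omega)
        _ = (r ^ 2) ^ (n + 9) := by rw [pow_mul]
        _ ≤ (1 + r ^ 2) ^ (n + 9) := by gcongr; linarith
        _ = _ := by ring
  have e := integral_Ioi_of_hasDerivAt_of_tendsto' (a := 0) (fun r _ => hd r)
    (((int_m n).const_mul _).add (h1.const_mul _)) ht
  rw [integral_add ((int_m n).const_mul _) (h1.const_mul _), integral_const_mul,
    integral_const_mul] at e
  simp only [ne_eq, Nat.add_eq_zero_iff, OfNat.ofNat_ne_zero, and_false, not_false_eq_true,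
    zero_pow, zero_mul, sub_zero] at e
  intro h
  rw [h] at e
  linarith

lemma f_eq (n : ℕ) (f : ℝ → ℝ) (r : ℝ) : f r = (1 + r ^ 2) ^ (-(((n : ℝ) + 9) / 2)) * uf n f r := by
  have hp : (0 : ℝ) < 1 + r ^ 2 := by positivity
  unfold uf
  rw [← mul_assoc, ← Real.rpow_add hp]
  simp

lemma sq_aux (a b m : ℝ) (h : (a - b) ^ 2 ≤ m) : a ^ 2 ≤ 2 * b ^ 2 + 2 * m := by
  nlinarith [sq_nonneg (a - 2 * b)]

lemma sq_aux2 (a b : ℝ) : (a + b) ^ 2 ≤ 2 * (a ^ 2 + b ^ 2) := by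
  nlinarith [sq_nonneg (a - b)]

lemma abs_aux (r : ℝ) : |1 - r ^ 2| ≤ 1 + r ^ 2 := by
  rw [abs_le]
  constructor <;> nlinarith

theorem oneD (n : ℕ) : ∃ D : ℝ, 0 < D ∧ ∀ f f1 f2 : ℝ → ℝ, (∀ r, HasDerivAt f (f1 r) r) →
    (∀ r, HasDerivAt f1 (f2 r) r) → Rap f → Rap f1 → Rap f2 →
    0 ≤ Aint n f1 f2 - Bint n f ∧
    Bint n f ≤ D * ((Aint n f1 f2 - Bint n f) + Lint n f ^ 2) := by
  have hn : (0 : ℝ) ≤ n := Nat.cast_nonneg n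
  set p := ((n : ℝ) + 9) / 2 with hp
  set K : ℝ := ((n : ℝ) + 13) * ((n : ℝ) + 9) * (((n : ℝ) + 13) ^ 2 - 4) with hK
  have hK0 : 0 ≤ K := by
    have : 0 ≤ (((n : ℝ) + 13) ^ 2 - 4) := by nlinarith
    positivity
  set G3 : ℝ → ℝ := fun r => r ^ (n + 12) * (1 + r ^ 2) ^ (-((n : ℝ) + 9)) * r ^ p +
    r ^ (n + 12) * (1 + r ^ 2) ^ (-((n : ℝ) + 9)) * r ^ (-p) with hG3
  set G2 : ℝ → ℝ := fun r => r ^ (n + 12) * (1 + r ^ 2) ^ (-((n : ℝ) + 13)) * r ^ (2 * p) +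
    r ^ (n + 12) * (1 + r ^ 2) ^ (-((n : ℝ) + 13)) * r ^ (-(2 * p)) with hG2
  set G1 : ℝ → ℝ := fun r => r ^ (n + 12) * (1 + r ^ 2) ^ (-((n : ℝ) + 13)) with hG1
  have iG3 : IntegrableOn G3 (Ioi 0) :=
    (int_model_nat _ _ _ (by push_cast; linarith) (by push_cast; linarith)).add
      (int_model_nat _ _ _ (by push_cast; linarith) (by push_cast; linarith))
  have iG2 : IntegrableOn G2 (Ioi 0) :=
    (int_model_nat _ _ _ (by push_cast; linarith) (by push_cast; linarith)).add
      (int_model_nat _ _ _ (by push_cast; linarith) (by push_cast; linarith))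
  have iG1 : IntegrableOn G1 (Ioi 0) := int_model_nat' _ _ (by push_cast; linarith)
  set I1 := ∫ r in Ioi (0 : ℝ), G1 r with hI1
  set I2 := ∫ r in Ioi (0 : ℝ), G2 r with hI2
  set I3 := ∫ r in Ioi (0 : ℝ), G3 r with hI3
  have I1nn : 0 ≤ I1 := setIntegral_nonneg measurableSet_Ioi fun r hr => by
    have hr : 0 < r := hr
    simp only [hG1]; positivity
  have I2nn : 0 ≤ I2 := setIntegral_nonneg measurableSet_Ioi fun r hr => by
    have hr : 0 < r := hr
    simp only [hG2]; positivity
  set ℓ := ∫ r in Ioi (0 : ℝ), mfun n r with hℓ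
  have hℓ0 : 0 < ℓ ^ 2 := by
    have := m_ne n
    positivity
  set P : ℝ := (2 ^ (n + 11)) ^ 2 with hPdef
  have hP0 : 0 ≤ P := by positivity
  set D1 : ℝ := 2 * K * I1 * (2 / ℓ ^ 2) with hD1
  set D2 : ℝ := 2 * K * I1 * (2 * P * I3 ^ 2 / ℓ ^ 2) + 4 * K * P * I2 with hD2
  have hD1n : 0 ≤ D1 := by positivity
  have hD2n : 0 ≤ D2 := by positivity
  clear_value D1 D2
  refine ⟨D1 + D2 + 1, by positivity, ?_⟩
  intro f f1 f2 hf hf1 h0 h1 h2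
  have hY0 := Y_nonneg n f f1 f2
  have hYle := Y_le (n := n) hf hf1 h0 h1 h2
  set Y := Yint n f f1 f2 with hY
  set u1 := uf n f 1 with hu1
  set M := 2 ^ (n + 11) * √Y with hM
  have hM0 : 0 ≤ M := by positivity
  have hM2 : M ^ 2 = P * Y := by rw [hM, mul_pow, Real.sq_sqrt hY0]
  have hv : ∀ r : ℝ, 0 < r → |uf n f r - u1| ≤ M * (r ^ p + r ^ (-p)) := fun r hr =>
    u_bound hf hf1 h0 h1 h2 hr
  have iB := (rap_B (n := n) h0).integrableOn
  have eB : Bint n f = ∫ r in Ioi (0 : ℝ), r ^ (n + 12) * (K / (1 + r ^ 2) ^ 4) * f r ^ 2 := rfl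
  rw [← hK] at iB
  clear_value M u1 Y P ℓ I1 I2 I3 G1 G2 G3 K p
  refine ⟨hY0.trans hYle, ?_⟩
  -- the linear functional
  have rL : Rap (fun r => r ^ (n + 12) * ((1 - r ^ 2) * (1 + r ^ 2) ^ (-(((n : ℝ) + 11) / 2))
      * f r)) := by
    have := h0.mul_slow ((Slow.pow (n + 12)).mul (((Slow.const 1).add ((Slow.const (-1)).mul
      (Slow.pow 2))).mul (Slow.rho (-(((n : ℝ) + 11) / 2)) (by linarith))))
    convert this using 1
    funext r
    ring
  have eL : ∀ r : ℝ, r ^ (n + 12) * ((1 - r ^ 2) * (1 + r ^ 2) ^ (-(((n : ℝ) + 11) / 2)) * f r)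
      = mfun n r * uf n f r := by
    intro r
    have hρ : (0 : ℝ) < 1 + r ^ 2 := by positivity
    rw [f_eq n f r]
    have : (1 + r ^ 2) ^ (-((n : ℝ) + 10)) =
        (1 + r ^ 2) ^ (-(((n : ℝ) + 11) / 2)) * (1 + r ^ 2) ^ (-(((n : ℝ) + 9) / 2)) := by
      rw [← Real.rpow_add hρ]
      congr 1
      ring
    simp only [mfun, this]
    ring
  have iL := rL.integrableOn
  have hL : Lint n f = ∫ r in Ioi (0 : ℝ), mfun n r * uf n f r := by
    unfold Lint
    simp only [eL]
  simp only [eL] at iL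
  have hdiff : |Lint n f - u1 * ℓ| ≤ M * I3 := by
    have e : Lint n f - u1 * ℓ = ∫ r in Ioi (0 : ℝ), (mfun n r * uf n f r - u1 * mfun n r) := by
      rw [integral_sub iL ((int_m n).const_mul _), hL, integral_const_mul, ← hℓ]
    rw [e, hI3, ← integral_const_mul, ← Real.norm_eq_abs]
    refine norm_integral_le_of_norm_le (iG3.const_mul M) ?_
    filter_upwards [ae_restrict_mem measurableSet_Ioi] with r hr
    have hr : 0 < r := hr
    have hρ : (0 : ℝ) < 1 + r ^ 2 := by positivity
    rw [show mfun n r * uf n f r - u1 * mfun n r = mfun n r * (uf n f r - u1) by ring,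
      Real.norm_eq_abs, abs_mul]
    have hm : |mfun n r| ≤ r ^ (n + 12) * (1 + r ^ 2) ^ (-((n : ℝ) + 9)) := by
      have e2 : (1 + r ^ 2) ^ (-((n : ℝ) + 9)) = (1 + r ^ 2) ^ (-((n : ℝ) + 10)) * (1 + r ^ 2) := by
        rw [← Real.rpow_add_one hρ.ne']
        congr 1
        ring
      rw [e2, mfun, abs_mul, abs_mul, abs_of_pos (show 0 < r ^ (n + 12) by positivity),
        abs_of_pos (show 0 < (1 + r ^ 2) ^ (-((n : ℝ) + 10)) by positivity)]
      have : |1 - r ^ 2| ≤ 1 + r ^ 2 := abs_aux r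
      calc r ^ (n + 12) * |1 - r ^ 2| * (1 + r ^ 2) ^ (-((n : ℝ) + 10))
          ≤ r ^ (n + 12) * (1 + r ^ 2) * (1 + r ^ 2) ^ (-((n : ℝ) + 10)) := by gcongr
        _ = _ := by ring
    calc |mfun n r| * |uf n f r - u1|
        ≤ (r ^ (n + 12) * (1 + r ^ 2) ^ (-((n : ℝ) + 9))) * (M * (r ^ p + r ^ (-p))) :=
          mul_le_mul hm (hv r hr) (abs_nonneg _) (by positivity)
      _ = M * G3 r := by simp only [hG3]; ring
  have hu : u1 ^ 2 ≤ (2 / ℓ ^ 2) * Lint n f ^ 2 + (2 * P * I3 ^ 2 / ℓ ^ 2) * Y := by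
    have h3 : (Lint n f - u1 * ℓ) ^ 2 ≤ (M * I3) ^ 2 := sq_le_sq.mpr (hdiff.trans (le_abs_self _))
    have h4 : (u1 * ℓ) ^ 2 ≤ 2 * Lint n f ^ 2 + 2 * (M * I3) ^ 2 := by
      refine sq_aux _ _ _ ?_
      rw [sub_sq_comm]
      exact h3
    rw [mul_pow M, hM2, mul_pow] at h4
    rw [show (2 / ℓ ^ 2) * Lint n f ^ 2 + (2 * P * I3 ^ 2 / ℓ ^ 2) * Y
      = (2 * Lint n f ^ 2 + 2 * (P * Y * I3 ^ 2)) / ℓ ^ 2 by ring, le_div_iff₀ hℓ0]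
    exact h4
  -- the weighted square
  have hB : Bint n f ≤ 2 * K * I1 * u1 ^ 2 + 4 * K * P * I2 * Y := by
    have e : 2 * K * I1 * u1 ^ 2 + 4 * K * P * I2 * Y
        = ∫ r in Ioi (0 : ℝ), ((2 * K * u1 ^ 2) * G1 r + (4 * K * P * Y) * G2 r) := by
      rw [integral_add (iG1.const_mul _) (iG2.const_mul _), integral_const_mul, integral_const_mul,
        ← hI1, ← hI2]
      ring
    rw [e, eB]
    refine setIntegral_mono_on iB
      ((iG1.const_mul _).add (iG2.const_mul _)) measurableSet_Ioi fun r hr => ?_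
    have hr : 0 < r := hr
    have hρ : (0 : ℝ) < 1 + r ^ 2 := by positivity
    have e1 : r ^ (n + 12) * (K / (1 + r ^ 2) ^ 4) * f r ^ 2 = K * G1 r * uf n f r ^ 2 := by
      rw [f_eq n f r]
      have : (1 + r ^ 2) ^ (-((n : ℝ) + 13)) =
          ((1 + r ^ 2) ^ 4)⁻¹ * ((1 + r ^ 2) ^ (-(((n : ℝ) + 9) / 2))) ^ 2 := by
        generalize 1 + r ^ 2 = x at *
        rw [← Real.rpow_natCast, ← Real.rpow_natCast, ← Real.rpow_neg hρ.le,
          ← Real.rpow_mul hρ.le, ← Real.rpow_add hρ]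
        congr 1
        push_cast
        ring
      simp only [hG1, this]
      ring
    rw [e1]
    have hu2 : uf n f r ^ 2 ≤ 2 * u1 ^ 2 + 4 * (P * Y) * (r ^ (2 * p) + r ^ (-(2 * p))) := by
      have h3 := sq_le_sq.mpr ((hv r hr).trans (le_abs_self _))
      have s1 : r ^ (2 * p) = (r ^ p) ^ 2 := by
        rw [← Real.rpow_natCast, ← Real.rpow_mul hr.le]; congr 1; push_cast; ring
      have s2 : r ^ (-(2 * p)) = (r ^ (-p)) ^ 2 := by
        rw [← Real.rpow_natCast, ← Real.rpow_mul hr.le]; congr 1; push_cast; ring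
      rw [s1, s2, ← hM2]
      rw [mul_pow] at h3
      have h4 : M ^ 2 * (r ^ p + r ^ (-p)) ^ 2 ≤ M ^ 2 * (2 * ((r ^ p) ^ 2 + (r ^ (-p)) ^ 2)) := by
        gcongr
        exact sq_aux2 _ _
      refine (sq_aux _ _ _ (h3.trans h4)).trans (le_of_eq ?_)
      ring
    have hg : 0 ≤ K * G1 r := by
      simp only [hG1]; positivity
    calc K * G1 r * uf n f r ^ 2
        ≤ K * G1 r * (2 * u1 ^ 2 + 4 * (P * Y) * (r ^ (2 * p) + r ^ (-(2 * p)))) := by gcongr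
      _ = _ := by simp only [hG1, hG2]; ring
  have hB2 : Bint n f ≤ D1 * Lint n f ^ 2 + D2 * Y := by
    have : 2 * K * I1 * u1 ^ 2 ≤
        2 * K * I1 * ((2 / ℓ ^ 2) * Lint n f ^ 2 + (2 * P * I3 ^ 2 / ℓ ^ 2) * Y) := by gcongr
    rw [hD1, hD2]
    linarith
  have hl2 := sq_nonneg (Lint n f)
  have t1 : D2 * Y ≤ D2 * (Aint n f1 f2 - Bint n f) := by gcongr
  have t2 := mul_nonneg hD1n (hY0.trans hYle)
  have t3 := mul_nonneg hD2n hl2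
  have t4 : (D1 + D2 + 1) * ((Aint n f1 f2 - Bint n f) + Lint n f ^ 2)
      = D1 * (Aint n f1 f2 - Bint n f) + D2 * (Aint n f1 f2 - Bint n f)
        + (Aint n f1 f2 - Bint n f) + D1 * Lint n f ^ 2 + D2 * Lint n f ^ 2 + Lint n f ^ 2 := by
    ring
  rw [t4]
  linarith [hY0.trans hYle]

lemma hasFDerivAt_radial {N : ℕ} {h h1 : ℝ → ℝ} {x : Rn N} (hx : x ≠ 0)
    (hh : HasDerivAt h (h1 ‖x‖) ‖x‖) :
    HasFDerivAt (fun y : Rn N => h ‖y‖) ((h1 ‖x‖ / ‖x‖) • innerSL ℝ x) x := by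
  have hn : ‖x‖ ≠ 0 := norm_ne_zero_iff.mpr hx
  have a : HasFDerivAt (fun y : Rn N => ‖y‖ ^ 2) (2 • innerSL ℝ x) x :=
    (hasStrictFDerivAt_norm_sq x).hasFDerivAt
  have b : HasFDerivAt (fun y : Rn N => ‖y‖) ((1 / (2 * ‖x‖)) • (2 • innerSL ℝ x)) x := by
    have := a.sqrt (by positivity)
    simpa [Real.sqrt_sq (norm_nonneg _)] using this
  have c := hh.comp_hasFDerivAt x b
  refine c.congr_fderiv ?_
  ext v
  simp
  field_simp

lemma lap_radial {N : ℕ} {f f1 f2 : ℝ → ℝ} (hf : ∀ r, HasDerivAt f (f1 r) r)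
    (hf1 : ∀ r, HasDerivAt f1 (f2 r) r) {g : Rn N → ℝ} (hg : ∀ x, g x = f ‖x‖)
    {x : Rn N} (hx : x ≠ 0) :
    lapR g x = f2 ‖x‖ + ((N : ℝ) - 1) / ‖x‖ * f1 ‖x‖ := by
  have hn : ‖x‖ ≠ 0 := norm_ne_zero_iff.mpr hx
  have hg' : g = fun y => f ‖y‖ := funext hg
  have e1 : fderiv ℝ g =ᶠ[𝓝 x] fun y => (f1 ‖y‖ / ‖y‖) • innerSL ℝ y := by
    filter_upwards [isOpen_ne.mem_nhds hx] with y hy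
    rw [hg']
    exact (hasFDerivAt_radial hy (hf _)).fderiv
  have q : HasDerivAt (fun r => f1 r / r) ((f2 ‖x‖ * ‖x‖ - f1 ‖x‖ * 1) / ‖x‖ ^ 2) ‖x‖ :=
    (hf1 ‖x‖).div (hasDerivAt_id' _) hn
  have q1 := hasFDerivAt_radial (h := fun r => f1 r / r)
    (h1 := fun r => (f2 r * r - f1 r * 1) / r ^ 2) hx q
  have q2 := q1.smul (innerSL ℝ (E := Rn N)).hasFDerivAt
  have e2 : fderiv ℝ (fderiv ℝ g) x = _ := e1.fderiv_eq.trans q2.fderiv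
  have hs : ∑ i : Fin N, x i ^ 2 = ‖x‖ ^ 2 := by
    rw [EuclideanSpace.norm_sq_eq]
    simp
  have key : ∀ i : Fin N, iteratedFDeriv ℝ 2 g x (fun _ => EuclideanSpace.single i 1)
      = f1 ‖x‖ / ‖x‖ + ((f2 ‖x‖ * ‖x‖ - f1 ‖x‖ * 1) / ‖x‖ ^ 2 / ‖x‖) * x i ^ 2 := by
    intro i
    have i1 : innerSL ℝ x (EuclideanSpace.single i (1 : ℝ)) = x i := by
      rw [innerSL_apply_apply, EuclideanSpace.inner_single_right]
      simp
    have i2 : innerSL ℝ (EuclideanSpace.single i (1 : ℝ) : Rn N) (EuclideanSpace.single i (1 : ℝ))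
        = 1 := by
      rw [innerSL_apply_apply, real_inner_self_eq_norm_sq]
      simp
    rw [iteratedFDeriv_two_apply, e2]
    change f1 ‖x‖ / ‖x‖ * innerSL ℝ (EuclideanSpace.single i (1 : ℝ) : Rn N)
      (EuclideanSpace.single i (1 : ℝ)) +
      ((f2 ‖x‖ * ‖x‖ - f1 ‖x‖ * 1) / ‖x‖ ^ 2 / ‖x‖ *
        innerSL ℝ x (EuclideanSpace.single i (1 : ℝ))) *
        innerSL ℝ x (EuclideanSpace.single i (1 : ℝ)) = _
    rw [i1, i2]
    ring
  unfold lapR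
  simp only [key]
  rw [Finset.sum_add_distrib, ← Finset.mul_sum, hs]
  simp
  field_simp
  ring

lemma Lam_W {N : ℕ} (x : Rn N) : LamR (Wfun N) x =
    ((N : ℝ) * ((N : ℝ) - 4) * ((N : ℝ) ^ 2 - 4)) ^ (((N : ℝ) - 4) / 8) * (((N : ℝ) - 4) / 2) *
      ((1 - ‖x‖ ^ 2) * (1 + ‖x‖ ^ 2) ^ (-(((N : ℝ) - 2) / 2))) := by
  have hp : 0 < 1 + ‖x‖ ^ 2 := by positivity
  have a : HasFDerivAt (fun y : Rn N => 1 + ‖y‖ ^ 2) (2 • innerSL ℝ x) x :=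
    (hasStrictFDerivAt_norm_sq x).hasFDerivAt.const_add 1
  have b := (a.rpow_const (p := -(((N : ℝ) - 4) / 2)) (Or.inl hp.ne')).const_mul
    (((N : ℝ) * ((N : ℝ) - 4) * ((N : ℝ) ^ 2 - 4)) ^ (((N : ℝ) - 4) / 8))
  have c : fderiv ℝ (Wfun N) x = _ := HasFDerivAt.fderiv b
  unfold LamR
  rw [c]
  unfold Wfun
  have e1 : -(((N : ℝ) - 4) / 2) - 1 = -(((N : ℝ) - 2) / 2) := by ring
  have e2 : (1 + ‖x‖ ^ 2) ^ (-(((N : ℝ) - 4) / 2))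
      = (1 + ‖x‖ ^ 2) ^ (-(((N : ℝ) - 2) / 2)) * (1 + ‖x‖ ^ 2) := by
    rw [← Real.rpow_add_one hp.ne']
    congr 1
    ring
  rw [e1, e2]
  simp only [_root_.smul_apply, innerSL_apply_apply, real_inner_self_eq_norm_sq,
    smul_eq_mul, nsmul_eq_mul]
  push_cast
  ring

lemma W_pow {N : ℕ} (hN : 13 ≤ N) (x : Rn N) : Wfun N x ^ ((8 : ℝ) / ((N : ℝ) - 4)) =
    (N : ℝ) * ((N : ℝ) - 4) * ((N : ℝ) ^ 2 - 4) / (1 + ‖x‖ ^ 2) ^ 4 := by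
  have hN' : (13 : ℝ) ≤ N := by exact_mod_cast hN
  have hp : 0 < 1 + ‖x‖ ^ 2 := by positivity
  have hK : 0 ≤ (N : ℝ) * ((N : ℝ) - 4) * ((N : ℝ) ^ 2 - 4) := by
    have h1 : 0 ≤ (N : ℝ) - 4 := by linarith
    have h2 : 0 ≤ (N : ℝ) ^ 2 - 4 := by nlinarith
    positivity
  have h4 : (N : ℝ) - 4 ≠ 0 := by linarith
  unfold Wfun
  generalize 1 + ‖x‖ ^ 2 = y at *
  generalize (N : ℝ) * ((N : ℝ) - 4) * ((N : ℝ) ^ 2 - 4) = K at *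
  rw [Real.mul_rpow (by positivity) (by positivity), ← Real.rpow_mul hK, ← Real.rpow_mul hp.le,
    show ((N : ℝ) - 4) / 8 * (8 / ((N : ℝ) - 4)) = 1 by field_simp,
    show -(((N : ℝ) - 4) / 2) * (8 / ((N : ℝ) - 4)) = -((4 : ℕ) : ℝ) by
      field_simp; norm_num, Real.rpow_one, Real.rpow_neg hp.le, Real.rpow_natCast]
  rfl

lemma int_radial (n : ℕ) (F : ℝ → ℝ) : ∫ x : Rn (n + 13), F ‖x‖ =
    (((n : ℝ) + 13) * (volume : Measure (Rn (n + 13))).real (Metric.ball 0 1)) *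
      ∫ r in Ioi (0 : ℝ), r ^ (n + 12) * F r := by
  rw [integral_fun_norm_addHaar (volume : Measure (Rn (n + 13))) F]
  simp
  ring

lemma stmt_aux (n : ℕ) :
    ∃ c C : ℝ, 0 < c ∧ 0 < C ∧
      ∀ g : SchwartzMap (Rn (n + 13)) ℝ,
        (∀ x y : Rn (n + 13), ‖x‖ = ‖y‖ → g x = g y) →
        (∫ x : Rn (n + 13), (lapR (⇑g) x) ^ 2)
            - (∫ x : Rn (n + 13), Wfun (n + 13) x ^ ((8 : ℝ) / (((n + 13 : ℕ) : ℝ) - 4)) * (g x) ^ 2)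
          ≥ c * (∫ x : Rn (n + 13), (lapR (⇑g) x) ^ 2)
            - C * (∫ x : Rn (n + 13), LamR (Wfun (n + 13)) x * g x) ^ 2 := by
  obtain ⟨D, hD, H⟩ := oneD n
  have hn : (0 : ℝ) ≤ n := Nat.cast_nonneg n
  have hcast : ((n + 13 : ℕ) : ℝ) = (n : ℝ) + 13 := by push_cast; ring
  obtain ⟨κ, hκ⟩ : ∃ κ : ℝ, κ =
    ((n : ℝ) + 13) * (volume : Measure (Rn (n + 13))).real (Metric.ball 0 1) := ⟨_, rfl⟩
  have hκ0 : 0 < κ := by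
    have : 0 < (volume : Measure (Rn (n + 13))).real (Metric.ball 0 1) :=
      ENNReal.toReal_pos (Metric.measure_ball_pos _ _ one_pos).ne' measure_ball_lt_top.ne
    rw [hκ]
    positivity
  obtain ⟨q, hq⟩ : ∃ q : ℝ, q = ((((n + 13 : ℕ) : ℝ)) * ((((n + 13 : ℕ) : ℝ)) - 4) *
    ((((n + 13 : ℕ) : ℝ)) ^ 2 - 4)) ^ (((((n + 13 : ℕ) : ℝ)) - 4) / 8) *
      (((((n + 13 : ℕ) : ℝ)) - 4) / 2) := ⟨_, rfl⟩
  have hq0 : 0 < q := by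
    have h1 : 0 < (((n + 13 : ℕ) : ℝ)) - 4 := by rw [hcast]; linarith
    have h2 : 0 < (((n + 13 : ℕ) : ℝ)) ^ 2 - 4 := by rw [hcast]; nlinarith
    rw [hq]
    positivity
  refine ⟨1 / (1 + D), D / (1 + D) / (κ * q ^ 2), by positivity, by positivity, ?_⟩
  intro g hg
  -- the radial profile
  let e : Rn (n + 13) := EuclideanSpace.single 0 1
  have he : ‖e‖ = 1 := by simp [e]
  let φ : ℝ →L[ℝ] Rn (n + 13) := ContinuousLinearMap.toSpanSingleton ℝ e
  have hφ : ∀ t, φ t = t • e := fun t => by simp [φ]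
  have hanti : AntilipschitzWith 1 φ := by
    refine AntilipschitzWith.of_le_mul_dist fun s t => ?_
    rw [hφ, hφ, dist_eq_norm, dist_eq_norm, ← sub_smul, norm_smul, he]
    simp
  let f : SchwartzMap ℝ ℝ := SchwartzMap.compCLMOfAntilipschitz ℝ φ.hasTemperateGrowth hanti g
  let f1 : SchwartzMap ℝ ℝ := SchwartzMap.derivCLM ℝ ℝ f
  let f2 : SchwartzMap ℝ ℝ := SchwartzMap.derivCLM ℝ ℝ f1
  have hf : ∀ r, HasDerivAt f (f1 r) r := fun r => f.hasDerivAt r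
  have hf1 : ∀ r, HasDerivAt f1 (f2 r) r := fun r => f1.hasDerivAt r
  have hgf : ∀ x, g x = f ‖x‖ := by
    intro x
    have : f ‖x‖ = g (φ ‖x‖) := rfl
    rw [this]
    apply hg
    rw [hφ, norm_smul, he]
    simp
  obtain ⟨H1, H2⟩ := H f f1 f2 hf hf1 (rap_schwartz f) (rap_schwartz f1) (rap_schwartz f2)
  have EA : (∫ x : Rn (n + 13), (lapR (⇑g) x) ^ 2) = κ * Aint n f1 f2 := by
    have e1 : (∫ x : Rn (n + 13), (lapR (⇑g) x) ^ 2) =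
        ∫ x : Rn (n + 13), (fun r => (f2 r + ((n : ℝ) + 12) / r * f1 r) ^ 2) ‖x‖ := by
      refine integral_congr_ae ?_
      have h0 : ∀ᵐ x : Rn (n + 13), x ≠ 0 := by
        simp [ae_iff]
      filter_upwards [h0] with x hx
      rw [lap_radial hf hf1 hgf hx, hcast, show (n : ℝ) + 13 - 1 = (n : ℝ) + 12 by ring]
    rw [e1, int_radial n (fun r => (f2 r + ((n : ℝ) + 12) / r * f1 r) ^ 2), ← hκ, Aint]
    congr 1
    refine setIntegral_congr_fun measurableSet_Ioi fun r hr => ?_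
    have hr : 0 < r := hr
    field_simp
    ring
  have EB : (∫ x : Rn (n + 13), Wfun (n + 13) x ^ ((8 : ℝ) / (((n + 13 : ℕ) : ℝ) - 4)) * (g x) ^ 2)
      = κ * Bint n f := by
    have e1 : ∀ x : Rn (n + 13),
        Wfun (n + 13) x ^ ((8 : ℝ) / (((n + 13 : ℕ) : ℝ) - 4)) * (g x) ^ 2
        = (fun r => ((n : ℝ) + 13) * ((n : ℝ) + 9) * (((n : ℝ) + 13) ^ 2 - 4)
        / (1 + r ^ 2) ^ 4 * f r ^ 2) ‖x‖ := by
      intro x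
      rw [W_pow (by omega), hgf, hcast]
      simp only
      ring
    simp only [e1]
    rw [int_radial n (fun r => ((n : ℝ) + 13) * ((n : ℝ) + 9) * (((n : ℝ) + 13) ^ 2 - 4)
        / (1 + r ^ 2) ^ 4 * f r ^ 2), ← hκ, Bint]
    simp only [mul_assoc]
  have EL : (∫ x : Rn (n + 13), LamR (Wfun (n + 13)) x * g x) = κ * q * Lint n f := by
    have e1 : ∀ x : Rn (n + 13), LamR (Wfun (n + 13)) x * g x
        = (fun r => q * ((1 - r ^ 2) * (1 + r ^ 2) ^ (-(((n : ℝ) + 11) / 2)) * f r)) ‖x‖ := by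
      intro x
      rw [Lam_W, hgf, ← hq, hcast, show (n : ℝ) + 13 - 2 = (n : ℝ) + 11 by ring]
      simp only
      ring
    simp only [e1]
    rw [int_radial n (fun r => q * ((1 - r ^ 2) * (1 + r ^ 2) ^ (-(((n : ℝ) + 11) / 2)) * f r)),
      ← hκ, Lint, mul_assoc κ q, ← integral_const_mul q]
    congr 1
    refine integral_congr_ae (Eventually.of_forall fun r => ?_)
    simp only
    ring
  rw [EA, EB, EL, ge_iff_le]
  generalize Aint n f1 f2 = A at *
  generalize Bint n f = B at *
  generalize Lint n f = L at *
  have e3 : 1 / (1 + D) * (κ * A) - D / (1 + D) / (κ * q ^ 2) * (κ * q * L) ^ 2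
      = κ * ((A - D * L ^ 2) / (1 + D)) := by
    field_simp
  rw [e3, ← mul_sub]
  refine mul_le_mul_of_nonneg_left ?_ hκ0.le
  rw [div_le_iff₀ (by positivity)]
  linarith


end Aux

theorem stmt_12 (N : ℕ) (hN : 13 ≤ N) :
    ∃ c C : ℝ, 0 < c ∧ 0 < C ∧
      ∀ g : SchwartzMap (Rn N) ℝ,
        (∀ x y : Rn N, ‖x‖ = ‖y‖ → g x = g y) →
        (∫ x : Rn N, (lapR (⇑g) x) ^ 2)
            - (∫ x : Rn N, Wfun N x ^ ((8 : ℝ) / ((N : ℝ) - 4)) * (g x) ^ 2)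
          ≥ c * (∫ x : Rn N, (lapR (⇑g) x) ^ 2)
            - C * (∫ x : Rn N, LamR (Wfun N) x * g x) ^ 2 := by
  obtain ⟨n, rfl⟩ : ∃ n, N = n + 13 := ⟨N - 13, by omega⟩
  exact stmt_aux n
end
end
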